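/- For every integer r ≥ 5 there exists γ > 0 with the following property. Let p = p(n) ∈ (0,1) satisfy p(n) ≤ n^(−2/r+γ) for all n and μ_r → ∞ as n → ∞, and let ω : ℕ → ℝ be any function with ω(n) → ∞. Then there exist a constant K > 0 and, for each n, a collection 𝓖_n of r-uniform hypergraphs on [n] such that P(H_r(G(n,p(n))) ∈ 𝓖_n) → 1 as n → ∞, and for all sufficiently large n and every H ∈ 𝓖_n, P(H_r(G(n,p(n))) = H) lies between exp(−K(ω(n)·μ_{r+1} + n^(−γ))) and exp(K(ω(n)·μ_{r+1} + n^(−γ))) times π^(e(H)) · (1−π)^(C(n,r)−e(H)) · p^(−t(H)) · e^(−Λ(n,r)), where μ_{r+1} = C(n,r+1)·p^(C(r+1,2)). -/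

import Mathlib

open Finset
open scoped Classical

/-- All 2-element subsets of `Fin n`: the potential edges of a graph on `[n]`. -/
def pairsUniv (n : ℕ) : Finset (Finset (Fin n)) :=
  Finset.powersetCard 2 (Finset.univ : Finset (Fin n))

/-- The probability that the random graph `G(n,p)` (identified with its edge set,
a set of 2-element subsets of `Fin n`, each present independently with probability `p`)
lies in the family `A`. -/
noncomputable def gnpProb (n : ℕ) (p : ℝ) (A : Set (Finset (Finset (Fin n)))) : ℝ :=
  ∑ G ∈ (pairsUniv n).powerset.filter (· ∈ A),
    p ^ G.card * (1 - p) ^ ((pairsUniv n).card - G.card)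

/-- The expectation of `f (G(n,p))`. -/
noncomputable def gnpExpect (n : ℕ) (p : ℝ) (f : Finset (Finset (Fin n)) → ℝ) : ℝ :=
  ∑ G ∈ (pairsUniv n).powerset,
    p ^ G.card * (1 - p) ^ ((pairsUniv n).card - G.card) * f G

/-- The `r`-uniform hypergraph `H_r(G)` on `[n]` whose hyperedges are the `r`-element
vertex sets inducing a clique of the graph `G`. -/
def cliqueHyp (n r : ℕ) (G : Finset (Finset (Fin n))) : Finset (Finset (Fin n)) :=
  (Finset.powersetCard r (Finset.univ : Finset (Fin n))).filter
    (fun S => Finset.powersetCard 2 S ⊆ G)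

/-- The graph `G(H)` whose edges are the vertex pairs contained in some hyperedge of `H`. -/
def hypGraph (n : ℕ) (H : Finset (Finset (Fin n))) : Finset (Finset (Fin n)) :=
  (pairsUniv n).filter (fun e => ∃ h ∈ H, e ⊆ h)

/-- `t(H) = C(r,2)·e(H) − e(G(H))`. -/
def tHyp (n r : ℕ) (H : Finset (Finset (Fin n))) : ℤ :=
  (r.choose 2 : ℤ) * H.card - ((hypGraph n H).card : ℤ)

/-- `μ_r = C(n,r)·p^(C(r,2))`, the expected number of copies of `K_r` in `G(n,p)`. -/
noncomputable def muR (n r : ℕ) (p : ℝ) : ℝ := (n.choose r : ℝ) * p ^ r.choose 2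

/-- `Λ(n,r)`. -/
noncomputable def Lam (n r : ℕ) (p : ℝ) : ℝ :=
  (1/2) * ∑ s ∈ Finset.Icc 2 (r - 1),
    (n.choose r : ℝ) * (r.choose s : ℝ) * ((n - r).choose (r - s) : ℝ) *
      p ^ (2 * r.choose 2) * ((p ^ s.choose 2)⁻¹ - 1)



open Finset
open scoped Classical

/-- Expectation of `f` over the binomial random subset of `E`. -/
noncomputable def ex {α : Type*} [DecidableEq α] (E : Finset α) (p : ℝ) (f : Finset α → ℝ) : ℝ :=
  ∑ G ∈ E.powerset, p ^ G.card * (1 - p) ^ (E.card - G.card) * f G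

section Abstract
variable {α : Type*} [DecidableEq α]

lemma ex_congr {E : Finset α} {p : ℝ} {f g : Finset α → ℝ} (h : ∀ G ⊆ E, f G = g G) :
    ex E p f = ex E p g := by
  unfold ex
  refine Finset.sum_congr rfl fun G hG => ?_
  rw [h G (Finset.mem_powerset.1 hG)]

lemma ex_mono {E : Finset α} {p : ℝ} (hp : 0 ≤ p) (hp1 : p ≤ 1) {f g : Finset α → ℝ}
    (h : ∀ G ⊆ E, f G ≤ g G) : ex E p f ≤ ex E p g := by
  unfold ex
  refine Finset.sum_le_sum fun G hG => ?_
  have := h G (Finset.mem_powerset.1 hG)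
  have h1 : 0 ≤ 1 - p := by linarith
  gcongr

lemma ex_nonneg {E : Finset α} {p : ℝ} (hp : 0 ≤ p) (hp1 : p ≤ 1) {f : Finset α → ℝ}
    (h : ∀ G ⊆ E, 0 ≤ f G) : 0 ≤ ex E p f := by
  unfold ex
  refine Finset.sum_nonneg fun G hG => ?_
  have := h G (Finset.mem_powerset.1 hG)
  have h1 : 0 ≤ 1 - p := by linarith
  positivity

lemma ex_add (E : Finset α) (p : ℝ) (f g : Finset α → ℝ) :
    ex E p (fun G => f G + g G) = ex E p f + ex E p g := by
  unfold ex
  rw [← Finset.sum_add_distrib]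
  exact Finset.sum_congr rfl fun G _ => by ring

lemma ex_sub (E : Finset α) (p : ℝ) (f g : Finset α → ℝ) :
    ex E p (fun G => f G - g G) = ex E p f - ex E p g := by
  unfold ex
  rw [← Finset.sum_sub_distrib]
  exact Finset.sum_congr rfl fun G _ => by ring

lemma ex_mul (E : Finset α) (p c : ℝ) (f : Finset α → ℝ) :
    ex E p (fun G => c * f G) = c * ex E p f := by
  unfold ex
  rw [Finset.mul_sum]
  exact Finset.sum_congr rfl fun G _ => by ring

lemma ex_sum {ι : Type*} (E : Finset α) (p : ℝ) (s : Finset ι) (f : ι → Finset α → ℝ) :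
    ex E p (fun G => ∑ i ∈ s, f i G) = ∑ i ∈ s, ex E p (f i) := by
  unfold ex
  rw [Finset.sum_comm]
  exact Finset.sum_congr rfl fun G _ => by rw [Finset.mul_sum]

lemma ex_one (E : Finset α) (p : ℝ) : ex E p (fun _ => 1) = 1 := by
  unfold ex
  simp only [mul_one]
  rw [Finset.sum_pow_mul_eq_add_pow p (1 - p) E]
  simp

lemma ex_const (E : Finset α) (p c : ℝ) : ex E p (fun _ => c) = c := by
  have := ex_mul E p c (fun _ => 1)
  simpa [ex_one] using this

lemma ex_insert {E : Finset α} {e : α} (he : e ∉ E) (p : ℝ) (f : Finset α → ℝ) :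
    ex (insert e E) p f = p * ex E p (fun G => f (insert e G)) + (1 - p) * ex E p f := by
  unfold ex
  rw [Finset.sum_powerset_insert he, add_comm, Finset.mul_sum, Finset.mul_sum]
  congr 1
  · refine Finset.sum_congr rfl fun G hG => ?_
    have hG' := Finset.mem_powerset.1 hG
    have : e ∉ G := fun h => he (hG' h)
    rw [Finset.card_insert_of_notMem this, Finset.card_insert_of_notMem he,
      Nat.add_sub_add_right]
    ring
  · refine Finset.sum_congr rfl fun G hG => ?_
    have hc := Finset.card_le_card (Finset.mem_powerset.1 hG)
    rw [Finset.card_insert_of_notMem he, Nat.sub_add_comm hc]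
    ring

lemma ex_incl_one {E : Finset α} {e : α} (he : e ∈ E) (p : ℝ) (f : Finset α → ℝ) :
    ex E p (fun G => if e ∈ G then f G else 0) = p * ex E p (fun G => f (insert e G)) := by
  obtain ⟨E', he', rfl⟩ : ∃ E', e ∉ E' ∧ insert e E' = E :=
    ⟨E.erase e, Finset.notMem_erase e E, Finset.insert_erase he⟩
  rw [ex_insert he', ex_insert he']
  have h0 : ex E' p (fun G => if e ∈ G then f G else 0) = 0 := by
    rw [ex_congr (g := fun _ => 0), ex_const]
    intro G hG
    rw [if_neg (fun h => he' (hG h))]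
  rw [h0]
  simp only [Finset.mem_insert_self, if_true, Finset.insert_idem]
  ring

lemma ex_incl {E A : Finset α} (hA : A ⊆ E) (p : ℝ) (f : Finset α → ℝ) :
    ex E p (fun G => if A ⊆ G then f G else 0) = p ^ A.card * ex E p (fun G => f (G ∪ A)) := by
  induction A using Finset.induction_on generalizing f with
  | empty => simp
  | insert a A ha ih =>
    have haE : a ∈ E := hA (Finset.mem_insert_self _ _)
    have hAE : A ⊆ E := fun x hx => hA (Finset.mem_insert_of_mem hx)
    have h1 : ex E p (fun G => if insert a A ⊆ G then f G else 0)
        = ex E p (fun G => if A ⊆ G then (if a ∈ G then f G else 0) else 0) := by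
      refine ex_congr fun G _ => ?_
      by_cases h2 : a ∈ G <;> by_cases h3 : A ⊆ G <;> simp [Finset.insert_subset_iff, h2, h3]
    rw [h1, ih hAE, Finset.card_insert_of_notMem ha]
    have h2 : ex E p (fun G => if a ∈ G ∪ A then f (G ∪ A) else 0)
        = ex E p (fun G => if a ∈ G then f (G ∪ A) else 0) := by
      refine ex_congr fun G _ => ?_
      simp [ha]
    rw [h2, ex_incl_one haE p (fun G => f (G ∪ A))]
    simp only [Finset.insert_union, Finset.union_insert]
    ring

lemma ex_subset {E A : Finset α} (hA : A ⊆ E) (p : ℝ) :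
    ex E p (fun G => if A ⊆ G then 1 else 0) = p ^ A.card := by
  rw [ex_incl hA p (fun _ => 1), ex_one, mul_one]

/-- Harris inequality. -/
lemma harris (E : Finset α) {p : ℝ} (hp : 0 ≤ p) (hp1 : p ≤ 1) (f g : Finset α → ℝ)
    (hf : Monotone f) (hg : Antitone g) :
    ex E p (fun G => f G * g G) ≤ ex E p f * ex E p g := by
  induction E using Finset.induction_on generalizing f g with
  | empty => simp [ex]
  | insert e E he ih =>
    rw [ex_insert he, ex_insert he, ex_insert he]
    have hm : Monotone (fun G : Finset α => insert e G) := fun a b h => Finset.insert_subset_insert e h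
    have h1 := ih (fun G => f (insert e G)) (fun G => g (insert e G)) (hf.comp hm)
      (hg.comp_monotone hm)
    have h0 := ih f g hf hg
    have hF : ex E p f ≤ ex E p (fun G => f (insert e G)) :=
      ex_mono hp hp1 fun G _ => hf (Finset.subset_insert e G)
    have hG : ex E p (fun G => g (insert e G)) ≤ ex E p g :=
      ex_mono hp hp1 fun G _ => hg (Finset.subset_insert e G)
    have hq : 0 ≤ 1 - p := by linarith
    have k1 := mul_le_mul_of_nonneg_left h1 hp
    have k0 := mul_le_mul_of_nonneg_left h0 hq
    have k2 := mul_nonneg (mul_nonneg hp hq) (mul_nonneg (sub_nonneg.2 hF) (sub_nonneg.2 hG))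
    nlinarith [k1, k0, k2]

lemma ex_pow_sdiff {E C : Finset α} (hC : C ⊆ E) {p : ℝ} (hp : 0 ≤ p) (hp1 : p ≤ 1) :
    ex E p (fun G => p ^ (C \ G).card) ≤ (2 * p) ^ C.card := by
  induction E using Finset.induction_on generalizing C with
  | empty =>
    have : C = ∅ := Finset.subset_empty.1 hC
    subst this
    simp [ex]
  | insert e E he ih =>
    rw [ex_insert he]
    by_cases heC : e ∈ C
    · have h1 : ∀ G : Finset α, C \ insert e G = C.erase e \ G := by
        intro G; ext x; simp; tauto
      have h2 : ex E p (fun G => p ^ (C \ G).card) = p * ex E p (fun G => p ^ (C.erase e \ G).card) := by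
        rw [← ex_mul]
        refine ex_congr fun G hG => ?_
        have h3 : C \ G = insert e (C.erase e \ G) := by
          ext x; simp only [Finset.mem_sdiff, Finset.mem_insert, Finset.mem_erase]
          by_cases hx : x = e
          · subst hx; simp only [heC, true_and]; simpa using fun h => he (hG h)
          · simp [hx]
        rw [h3, Finset.card_insert_of_notMem (by simp), pow_succ]
        ring
      simp only [h1]
      rw [h2]
      have h4 := ih (C := C.erase e) (by
        intro x hx
        have := hC (Finset.mem_of_mem_erase hx)
        simp only [Finset.mem_insert] at this
        exact this.resolve_left (Finset.ne_of_mem_erase hx))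
      have h5 : 0 ≤ ex E p (fun G => p ^ (C.erase e \ G).card) :=
        ex_nonneg hp hp1 fun G _ => by positivity
      have hc : C.card = (C.erase e).card + 1 := (Finset.card_erase_add_one heC).symm
      rw [hc, pow_succ]
      nlinarith [mul_nonneg hp h5, mul_nonneg (mul_nonneg hp hp) h5, mul_le_mul_of_nonneg_left h4 hp]
    · have h1 : ∀ G : Finset α, C \ insert e G = C \ G := by
        intro G; ext x; simp only [Finset.mem_sdiff, Finset.mem_insert]
        constructor
        · rintro ⟨a, b⟩; exact ⟨a, fun h => b (Or.inr h)⟩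
        · rintro ⟨a, b⟩; refine ⟨a, ?_⟩
          rintro (rfl | h)
          · exact heC a
          · exact b h
      simp only [h1]
      have h4 := ih (C := C) (fun x hx => by
        have := hC hx
        simp only [Finset.mem_insert] at this
        rcases this with rfl | h
        · exact absurd hx heC
        · exact h)
      linarith

lemma ex_mixed {E A B : Finset α} (hA : A ⊆ E) (hB : B ⊆ E) {p : ℝ} (hp : 0 ≤ p) (hp1 : p ≤ 1) :
    ex E p (fun G => if B ⊆ G then p ^ (A \ G).card else 0) ≤ (2 * p) ^ (A ∪ B).card := by
  rw [ex_incl hB p (fun G => p ^ (A \ G).card)]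
  have h1 : ∀ G : Finset α, A \ (G ∪ B) = (A \ B) \ G := by
    intro G; ext x; simp; tauto
  simp only [h1]
  have h2 := ex_pow_sdiff (E := E) (C := A \ B) (fun x hx => hA (Finset.mem_sdiff.1 hx).1) hp hp1
  have h3 : (A ∪ B).card = B.card + (A \ B).card := by
    rw [Finset.union_comm, ← Finset.union_sdiff_self_eq_union]
    exact Finset.card_union_of_disjoint Finset.disjoint_sdiff
  rw [h3, pow_add]
  have h4 : p ^ B.card ≤ (2 * p) ^ B.card := by gcongr; linarith
  have h5 : 0 ≤ ex E p (fun G => p ^ ((A \ B) \ G).card) :=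
        ex_nonneg hp hp1 fun G _ => by positivity
  gcongr

end Abstract


open Finset
open scoped Classical

set_option linter.unusedSectionVars false
set_option linter.unnecessarySimpa false

section Janson
variable {α : Type*} [DecidableEq α] {ι : Type*} [DecidableEq ι]

/-- Indicator that no `A j`, `j ∈ J`, is contained in `G`. -/
noncomputable def Zf (A : ι → Finset α) (J : Finset ι) (G : Finset α) : ℝ :=
  if ∀ j ∈ J, ¬ A j ⊆ G then 1 else 0

/-- Probability that no `A j` is contained in `G ∪ X`. -/
noncomputable def qf (E : Finset α) (p : ℝ) (A : ι → Finset α) (J : Finset ι) (X : Finset α) : ℝ :=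
  ex E p (fun G => Zf A J (G ∪ X))

lemma Zf_nonneg (A : ι → Finset α) (J : Finset ι) (G : Finset α) : 0 ≤ Zf A J G := by
  unfold Zf; split_ifs <;> norm_num

lemma Zf_le_one (A : ι → Finset α) (J : Finset ι) (G : Finset α) : Zf A J G ≤ 1 := by
  unfold Zf; split_ifs <;> norm_num

lemma Zf_anti (A : ι → Finset α) (J : Finset ι) : Antitone (Zf A J) := by
  intro G G' h
  unfold Zf
  split_ifs with h1 h2 h2
  · exact le_rfl
  · exact absurd (fun j hj hs => h1 j hj (hs.trans h)) h2
  · norm_num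
  · exact le_rfl

lemma Zf_union (A : ι → Finset α) (M N : Finset ι) (G : Finset α) :
    Zf A (M ∪ N) G = Zf A M G * Zf A N G := by
  unfold Zf
  by_cases h1 : ∀ j ∈ M, ¬ A j ⊆ G
  · by_cases h2 : ∀ j ∈ N, ¬ A j ⊆ G
    · rw [if_pos h1, if_pos h2, if_pos, one_mul]
      intro j hj
      rcases Finset.mem_union.1 hj with h | h
      · exact h1 j h
      · exact h2 j h
    · rw [if_neg h2, mul_zero, if_neg]
      exact fun h => h2 fun j hj => h j (Finset.mem_union_right _ hj)
  · rw [if_neg h1, zero_mul, if_neg]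
    exact fun h => h1 fun j hj => h j (Finset.mem_union_left _ hj)

/-- upper and lower Bonferroni -/
lemma Zf_upper (A : ι → Finset α) (N : Finset ι) (G : Finset α) :
    1 - Zf A N G ≤ ∑ j ∈ N, if A j ⊆ G then (1:ℝ) else 0 := by
  have hnn : ∀ j ∈ N, (0:ℝ) ≤ if A j ⊆ G then (1:ℝ) else 0 := by
    intro j _; split_ifs <;> norm_num
  unfold Zf
  split_ifs with h
  · simpa using Finset.sum_nonneg hnn
  · push Not at h
    obtain ⟨j, hj, hs⟩ := h
    have := Finset.single_le_sum hnn hj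
    rw [if_pos hs] at this
    linarith

lemma Zf_lower (A : ι → Finset α) (N : Finset ι) (G : Finset α) :
    (∑ j ∈ N, if A j ⊆ G then (1:ℝ) else 0)
      - (∑ j ∈ N, ∑ k ∈ N.erase j, if A j ∪ A k ⊆ G then (1:ℝ) else 0) ≤ 1 - Zf A N G := by
  set m : ℝ := ∑ j ∈ N, if A j ⊆ G then (1:ℝ) else 0 with hm
  have h2 : (∑ j ∈ N, ∑ k ∈ N.erase j, if A j ∪ A k ⊆ G then (1:ℝ) else 0) = m * m - m := by
    have : ∀ j ∈ N, (∑ k ∈ N.erase j, if A j ∪ A k ⊆ G then (1:ℝ) else 0)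
        = (if A j ⊆ G then (1:ℝ) else 0) * m - (if A j ⊆ G then (1:ℝ) else 0) := by
      intro j hj
      have h3 : m = (if A j ⊆ G then (1:ℝ) else 0) + ∑ k ∈ N.erase j, if A k ⊆ G then (1:ℝ) else 0 := by
        rw [hm]; exact (Finset.add_sum_erase N (fun k => if A k ⊆ G then (1:ℝ) else 0) hj).symm
      by_cases hj' : A j ⊆ G
      · simp only [hj', if_true] at h3 ⊢
        rw [h3]
        simp only [Finset.union_subset_iff, hj', true_and]
        ring
      · simp [Finset.union_subset_iff, hj']
    rw [Finset.sum_congr rfl this, Finset.sum_sub_distrib, ← Finset.sum_mul]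
  rw [h2]
  unfold Zf
  split_ifs with h
  · have : m = 0 := by
      rw [hm]; exact Finset.sum_eq_zero fun j hj => by rw [if_neg (h j hj)]
    rw [this]; norm_num
  · nlinarith [sq_nonneg (m - 1)]

lemma sub_union_iff (B G X : Finset α) : B ⊆ G ∪ X ↔ B \ X ⊆ G := by
  constructor
  · intro h x hx
    have h1 := Finset.mem_sdiff.1 hx
    exact (Finset.mem_union.1 (h h1.1)).resolve_right h1.2
  · intro h x hx
    by_cases hX : x ∈ X
    · exact Finset.mem_union_right _ hX
    · exact Finset.mem_union_left _ (h (Finset.mem_sdiff.2 ⟨hx, hX⟩))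

lemma mono_ind (B : Finset α) : Monotone (fun G : Finset α => if B ⊆ G then (1:ℝ) else 0) := by
  intro G G' h
  dsimp only
  split_ifs with h1 h2 h2
  · exact le_rfl
  · exact absurd (h1.trans h) h2
  · norm_num
  · exact le_rfl

lemma qf_nonneg {E : Finset α} {p : ℝ} (hp : 0 ≤ p) (hp1 : p ≤ 1) (A : ι → Finset α)
    (J : Finset ι) (X : Finset α) : 0 ≤ qf E p A J X :=
  ex_nonneg hp hp1 fun _ _ => Zf_nonneg _ _ _

lemma qf_le_one {E : Finset α} {p : ℝ} (hp : 0 ≤ p) (hp1 : p ≤ 1) (A : ι → Finset α)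
    (J : Finset ι) (X : Finset α) : qf E p A J X ≤ 1 := by
  rw [← ex_one E p]
  exact ex_mono hp hp1 fun _ _ => Zf_le_one _ _ _

lemma qf_anti {E : Finset α} {p : ℝ} (hp : 0 ≤ p) (hp1 : p ≤ 1) (A : ι → Finset α)
    {J J' : Finset ι} (h : J ⊆ J') (X : Finset α) : qf E p A J' X ≤ qf E p A J X := by
  refine ex_mono hp hp1 fun G _ => ?_
  rw [← Finset.union_sdiff_of_subset h, Zf_union]
  exact mul_le_of_le_one_right (Zf_nonneg _ _ _) (Zf_le_one _ _ _)

lemma qf_disj (E : Finset α) (p : ℝ) (A : ι → Finset α) (M : Finset ι) (X : Finset α)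
    (hM : ∀ k ∈ M, Disjoint (A k) X) : qf E p A M X = qf E p A M ∅ := by
  unfold qf
  refine ex_congr fun G _ => ?_
  unfold Zf
  congr 1
  refine propext (forall₂_congr fun j hj => ?_)
  rw [sub_union_iff, sub_union_iff, Finset.sdiff_eq_self_of_disjoint (hM j hj), Finset.sdiff_empty]

lemma ex_ind_Z {E : Finset α} {p : ℝ} (A : ι → Finset α) (M : Finset ι) (B X : Finset α)
    (hB : B ⊆ E) :
    ex E p (fun G => (if B ⊆ G ∪ X then (1:ℝ) else 0) * Zf A M (G ∪ X))
      = p ^ (B \ X).card * qf E p A M (B ∪ X) := by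
  have h1 := ex_incl (E := E) (A := B \ X) (fun x hx => hB (Finset.mem_sdiff.1 hx).1) p
    (fun G => Zf A M (G ∪ X))
  have h2 : ∀ G : Finset α, G ∪ (B \ X) ∪ X = G ∪ (B ∪ X) := by
    intro G; ext x; simp
  simp only [h2] at h1
  unfold qf
  rw [← h1]
  refine ex_congr fun G _ => ?_
  simp only [sub_union_iff]
  split_ifs <;> simp

lemma ex_ind_Z_le {E : Finset α} {p : ℝ} (hp : 0 ≤ p) (hp1 : p ≤ 1)
    (A : ι → Finset α) (M : Finset ι) (B X : Finset α) (hB : B ⊆ E) :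
    ex E p (fun G => (if B ⊆ G ∪ X then (1:ℝ) else 0) * Zf A M (G ∪ X))
      ≤ p ^ (B \ X).card * qf E p A M X := by
  have h1 := harris E hp hp1 (fun G => if B \ X ⊆ G then (1:ℝ) else 0) (fun G => Zf A M (G ∪ X))
    (mono_ind _) (fun G G' h => Zf_anti A M (Finset.union_subset_union_left h))
  rw [ex_subset (fun x hx => hB (Finset.mem_sdiff.1 hx).1)] at h1
  simp only [sub_union_iff]
  exact h1

lemma diff_eq (E : Finset α) (p : ℝ) (A : ι → Finset α) (M N : Finset ι) (X : Finset α) :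
    qf E p A M X - qf E p A (M ∪ N) X
      = ex E p (fun G => (1 - Zf A N (G ∪ X)) * Zf A M (G ∪ X)) := by
  unfold qf
  rw [← ex_sub]
  refine ex_congr fun G _ => ?_
  rw [Zf_union]; ring

lemma bnd_upper {E : Finset α} {p : ℝ} (hp : 0 ≤ p) (hp1 : p ≤ 1) (A : ι → Finset α)
    (hA : ∀ j, A j ⊆ E) (M N : Finset ι) (X : Finset α) (hM : ∀ k ∈ M, Disjoint (A k) X) :
    qf E p A M ∅ - qf E p A (M ∪ N) X ≤ (∑ j ∈ N, p ^ (A j \ X).card) * qf E p A M ∅ := by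
  rw [← qf_disj E p A M X hM, diff_eq]
  calc _ ≤ ex E p (fun G => ∑ j ∈ N, (if A j ⊆ G ∪ X then (1:ℝ) else 0) * Zf A M (G ∪ X)) := by
        refine ex_mono hp hp1 fun G _ => ?_
        rw [← Finset.sum_mul]
        exact mul_le_mul_of_nonneg_right (Zf_upper _ _ _) (Zf_nonneg _ _ _)
    _ ≤ _ := by
        rw [ex_sum, Finset.sum_mul]
        exact Finset.sum_le_sum fun j _ => ex_ind_Z_le hp hp1 A M (A j) X (hA j)

lemma q_low {E : Finset α} {p : ℝ} (hp : 0 ≤ p) (hp1 : p ≤ 1) (A : ι → Finset α)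
    (hA : ∀ j, A j ⊆ E) (M : Finset ι) (X : Finset α) :
    qf E p A M ∅ * (1 - ∑ k ∈ M with ¬ Disjoint (A k) X, p ^ (A k \ X).card) ≤ qf E p A M X := by
  have h := bnd_upper hp hp1 A hA (M.filter (fun k => Disjoint (A k) X))
    (M.filter (fun k => ¬ Disjoint (A k) X)) X (fun k hk => (Finset.mem_filter.1 hk).2)
  rw [Finset.filter_union_filter_not_eq] at h
  have h2 := qf_anti (E := E) hp hp1 A (Finset.filter_subset (fun k => Disjoint (A k) X) M) ∅
  have h3 := qf_nonneg (E := E) hp hp1 A M X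
  have h4 := qf_nonneg (E := E) hp hp1 A M ∅
  set s := ∑ k ∈ M with ¬ Disjoint (A k) X, p ^ (A k \ X).card
  by_cases hs : s ≤ 1
  · nlinarith
  · nlinarith

/-- Remainder term. -/
noncomputable def Rf (p : ℝ) (A : ι → Finset α) (M N : Finset ι) (X : Finset α) : ℝ :=
  (∑ j ∈ N, ∑ k ∈ N.erase j, p ^ ((A j ∪ A k) \ X).card)
    + ∑ j ∈ N, ∑ k ∈ M with ¬ Disjoint (A k) (A j), p ^ ((A j ∪ A k) \ X).card

lemma bnd_lower {E : Finset α} {p : ℝ} (hp : 0 ≤ p) (hp1 : p ≤ 1) (A : ι → Finset α)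
    (hA : ∀ j, A j ⊆ E) (M N : Finset ι) (X : Finset α) (hM : ∀ k ∈ M, Disjoint (A k) X) :
    ((∑ j ∈ N, p ^ (A j \ X).card) - Rf p A M N X) * qf E p A M ∅
      ≤ qf E p A M ∅ - qf E p A (M ∪ N) X := by
  rw [← qf_disj E p A M X hM, diff_eq]
  have h1 : ex E p (fun G => (∑ j ∈ N, (if A j ⊆ G ∪ X then (1:ℝ) else 0) * Zf A M (G ∪ X))
      - ∑ j ∈ N, ∑ k ∈ N.erase j, (if A j ∪ A k ⊆ G ∪ X then (1:ℝ) else 0) * Zf A M (G ∪ X))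
      ≤ ex E p (fun G => (1 - Zf A N (G ∪ X)) * Zf A M (G ∪ X)) := by
    refine ex_mono hp hp1 fun G _ => ?_
    simp only [← Finset.sum_mul]
    rw [← sub_mul]
    exact mul_le_mul_of_nonneg_right (Zf_lower _ _ _) (Zf_nonneg _ _ _)
  refine le_trans ?_ h1
  rw [ex_sub, ex_sum, ex_sum]
  have h2 : ∑ j ∈ N, ex E p (fun G => ∑ k ∈ N.erase j,
      (if A j ∪ A k ⊆ G ∪ X then (1:ℝ) else 0) * Zf A M (G ∪ X))
      ≤ (∑ j ∈ N, ∑ k ∈ N.erase j, p ^ ((A j ∪ A k) \ X).card) * qf E p A M X := by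
    rw [Finset.sum_mul]
    refine Finset.sum_le_sum fun j _ => ?_
    rw [ex_sum, Finset.sum_mul]
    exact Finset.sum_le_sum fun k _ => ex_ind_Z_le hp hp1 A M (A j ∪ A k) X
      (Finset.union_subset (hA j) (hA k))
  have h3 : ((∑ j ∈ N, p ^ (A j \ X).card) -
      ∑ j ∈ N, ∑ k ∈ M with ¬ Disjoint (A k) (A j), p ^ ((A j ∪ A k) \ X).card) * qf E p A M X
      ≤ ∑ j ∈ N, ex E p (fun G => (if A j ⊆ G ∪ X then (1:ℝ) else 0) * Zf A M (G ∪ X)) := by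
    rw [← Finset.sum_sub_distrib, Finset.sum_mul]
    refine Finset.sum_le_sum fun j _ => ?_
    rw [ex_ind_Z A M (A j) X (hA j)]
    have h4 := q_low hp hp1 A hA M (A j ∪ X)
    have h5 : (M.filter fun k => ¬ Disjoint (A k) (A j ∪ X)) = M.filter fun k => ¬ Disjoint (A k) (A j) := by
      refine Finset.filter_congr fun k hk => ?_
      rw [Finset.disjoint_union_right]
      simp [hM k hk]
    rw [h5, ← qf_disj E p A M X hM] at h4
    have h6 := mul_le_mul_of_nonneg_left h4 (pow_nonneg hp (A j \ X).card)
    refine le_trans (le_of_eq ?_) h6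
    rw [mul_left_comm, mul_comm (qf E p A M X), mul_sub, mul_one, Finset.mul_sum]
    congr 2
    refine Finset.sum_congr rfl fun k _ => ?_
    rw [← pow_add]
    congr 1
    rw [← Finset.card_union_of_disjoint]
    · congr 1; ext x; simp; tauto
    · rw [Finset.disjoint_left]; intro x hx; simp at hx ⊢; tauto
  unfold Rf
  nlinarith [h2, h3]

end Janson


open Finset
open scoped Classical
set_option linter.unusedSectionVars false

section Janson2
variable {α : Type*} [DecidableEq α] {ι : Type*} [DecidableEq ι]

lemma log_lower {x : ℝ} (_h0 : 0 ≤ x) (h1 : x ≤ 1/2) : -x - 2 * x ^ 2 ≤ Real.log (1 - x) := by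
  have h2 : 0 < 1 - x := by linarith
  have h3 := Real.one_sub_inv_le_log_of_pos h2
  have h4 : (1 - x)⁻¹ ≤ 1 + x + 2 * x ^ 2 := by
    rw [inv_le_iff_one_le_mul₀ h2]
    nlinarith [mul_nonneg (sq_nonneg x) (by linarith : 0 ≤ 1 - 2 * x)]
  linarith

lemma log_upper {x : ℝ} (h1 : x ≤ 1/2) : Real.log (1 - x) ≤ -x := by
  have := Real.log_le_sub_one_of_pos (by linarith : 0 < 1 - x)
  linarith

noncomputable def LJ (p : ℝ) (A : ι → Finset α) (J : Finset ι) : ℝ :=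
  -(∑ i ∈ J, p ^ (A i).card) + (1/2) * ∑ i ∈ J, ∑ j ∈ J,
    if i ≠ j then p ^ (A i ∪ A j).card - p ^ (A i).card * p ^ (A j).card else 0

noncomputable def T1J (p : ℝ) (A : ι → Finset α) (J : Finset ι) : ℝ :=
  ∑ i ∈ J, (p ^ (A i).card) ^ 2

noncomputable def T2J (p : ℝ) (A : ι → Finset α) (J : Finset ι) : ℝ :=
  ∑ i ∈ J, ∑ j ∈ J, if i ≠ j ∧ ¬ Disjoint (A j) (A i) then
    p ^ (A i ∪ A j).card * p ^ (A j).card else 0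

/-- chain condition, `j` is the centre -/
def c3 (A : ι → Finset α) (i j k : ι) : Prop :=
  i ≠ j ∧ j ≠ k ∧ k ≠ i ∧ ¬ Disjoint (A i) (A j) ∧ ¬ Disjoint (A k) (A j)

noncomputable def T3J (p : ℝ) (A : ι → Finset α) (J : Finset ι) : ℝ :=
  ∑ i ∈ J, ∑ j ∈ J, ∑ k ∈ J, if c3 A i j k then p ^ (A i ∪ A j ∪ A k).card else 0

/-- scalar step -/
lemma scalar_step {w b c β κ R0 Ri S D3 D2 : ℝ} (hw : 0 ≤ w) (hw1 : w ≤ 1/2)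
    (hb0 : 0 ≤ b) (hb1 : b ≤ 1) (hc0 : 0 ≤ c) (hc1 : c < 1) (hbc : c ≤ b)
    (hbβ : b ≤ β) (hβb : β - Ri ≤ b) (hcκ : c ≤ κ) (hκc : κ - R0 ≤ c)
    (hS : w * β = S) (hRi : w * Ri ≤ D3) (hR0 : w * R0 ≤ D3)
    (hκ2 : w * κ ^ 2 ≤ D3 + D2) (hβκ : w * (β * κ) ≤ D3 + D2) :
    |Real.log (1 - w * ((1 - b) / (1 - c))) - (-w + (S - w * κ))|
      ≤ 3 * D3 + 2 * D2 + 2 * w ^ 2 := by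
  have hc : 0 < 1 - c := by linarith
  set ρ := (1 - b) / (1 - c) with hρ
  have hρ0 : 0 ≤ ρ := div_nonneg (by linarith) hc.le
  have hρ1 : ρ ≤ 1 := by rw [hρ, div_le_one hc]; linarith
  have hmul : ρ * (1 - c) = 1 - b := div_mul_cancel₀ _ hc.ne'
  have hup : ρ ≤ 1 - b + c + 2 * c ^ 2 := by
    by_cases h : c ≤ 1/2
    · rw [hρ, div_le_iff₀ hc]
      nlinarith [mul_nonneg hb0 hc0, mul_nonneg (sq_nonneg c) (by linarith : 0 ≤ 1 - 2 * c)]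
    · nlinarith
  have hlo : 1 - b + c - b * c ≤ ρ := by
    rw [hρ, le_div_iff₀ hc]
    nlinarith [mul_nonneg (sq_nonneg c) (by linarith : 0 ≤ 1 - b)]
  have hx0 : 0 ≤ w * ρ := mul_nonneg hw hρ0
  have hxw : w * ρ ≤ w := mul_le_of_le_one_right hw hρ1
  have hl := log_lower hx0 (by linarith)
  have hu := log_upper (x := w * ρ) (by linarith)
  have hD : 0 ≤ D3 + D2 := le_trans (by positivity) hκ2
  have hx2 : (w * ρ) ^ 2 ≤ w ^ 2 := by gcongr
  have hκ0 : 0 ≤ κ := by linarith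
  have e1 : w * ρ ≤ w - S + D3 + w * κ + 2 * (D3 + D2) := by
    have k1 := mul_le_mul_of_nonneg_left hup hw
    have k2 := mul_le_mul_of_nonneg_left hβb hw
    have k3 := mul_le_mul_of_nonneg_left hcκ hw
    have k4 : w * c ^ 2 ≤ w * κ ^ 2 := by gcongr
    nlinarith
  have e2 : w - S + w * κ - D3 - (D3 + D2) ≤ w * ρ := by
    have k1 := mul_le_mul_of_nonneg_left hlo hw
    have k2 := mul_le_mul_of_nonneg_left hbβ hw
    have k3 := mul_le_mul_of_nonneg_left hκc hw
    have hβ0 : 0 ≤ β := by linarith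
    have k4 : w * (b * c) ≤ w * (β * κ) := by gcongr
    nlinarith
  rw [abs_le]
  constructor
  · nlinarith
  · nlinarith [sq_nonneg w]

lemma qf_insert {E : Finset α} {p : ℝ} (A : ι → Finset α) (hA : ∀ j, A j ⊆ E) (J : Finset ι) (i : ι) :
    qf E p A (insert i J) ∅ = qf E p A J ∅ - p ^ (A i).card * qf E p A J (A i) := by
  have h := diff_eq E p A J {i} ∅
  have h2 := ex_ind_Z (E := E) (p := p) A J (A i) ∅ (hA i)
  rw [Finset.sdiff_empty, Finset.union_empty] at h2
  rw [Finset.insert_eq, Finset.union_comm, ← h2]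
  have h3 : ex E p (fun G => (1 - Zf A {i} (G ∪ ∅)) * Zf A J (G ∪ ∅))
      = ex E p (fun G => (if A i ⊆ G ∪ ∅ then (1:ℝ) else 0) * Zf A J (G ∪ ∅)) := by
    refine ex_congr fun G _ => ?_
    congr 1
    unfold Zf
    by_cases hs : A i ⊆ G <;> simp [hs]
  rw [← h3, ← h]; ring

lemma pow_mul_le {p : ℝ} (hp : 0 ≤ p) (hp1 : p ≤ 1) (B C : Finset α) :
    p ^ B.card * p ^ C.card ≤ p ^ (B ∪ C).card := by
  rw [← pow_add]
  exact pow_le_pow_of_le_one hp hp1 (Finset.card_union_le B C)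

lemma pow_mul_sdiff {p : ℝ} (B C : Finset α) :
    p ^ B.card * p ^ (C \ B).card = p ^ (B ∪ C).card := by
  rw [← pow_add, ← Finset.card_union_of_disjoint Finset.disjoint_sdiff,
    Finset.union_sdiff_self_eq_union]

lemma janson_step {E : Finset α} {p : ℝ} (hp : 0 < p) (hp1 : p ≤ 1/2) (A : ι → Finset α)
    (hA : ∀ j, A j ⊆ E) (J : Finset ι) (i : ι) (hi : i ∉ J) (hne : (A i).Nonempty)
    (hq : 0 < qf E p A J ∅) (N M : Finset ι)
    (hN : N = J.filter (fun j => ¬ Disjoint (A j) (A i)))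
    (hM : M = J.filter (fun j => Disjoint (A j) (A i))) (D3 D2 : ℝ)
    (hD3 : D3 = (∑ j ∈ N, ∑ k ∈ N.erase j, p ^ (A i ∪ (A j ∪ A k)).card)
      + ∑ j ∈ N, ∑ k ∈ M with ¬ Disjoint (A k) (A j), p ^ (A i ∪ (A j ∪ A k)).card)
    (hD2 : D2 = ∑ j ∈ N, p ^ (A i ∪ A j).card * p ^ (A j).card) :
    0 < qf E p A (insert i J) ∅ ∧
    |Real.log (qf E p A (insert i J) ∅) - Real.log (qf E p A J ∅) -
      (-p ^ (A i).card + ∑ j ∈ J, (p ^ (A i ∪ A j).card - p ^ (A i).card * p ^ (A j).card))|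
      ≤ 3 * D3 + 2 * D2 + 2 * (p ^ (A i).card) ^ 2 := by
  have hp0 := hp.le
  have hp1' : p ≤ 1 := by linarith
  have hJ : M ∪ N = J := by rw [hM, hN, Finset.filter_union_filter_not_eq]
  have hJ' : Disjoint M N := by rw [hM, hN]; exact Finset.disjoint_filter_filter_not _ _ _
  have hMd : ∀ k ∈ M, Disjoint (A k) (A i) := by
    intro k hk; rw [hM] at hk; exact (Finset.mem_filter.1 hk).2
  have u1 := bnd_upper (E := E) hp0 hp1' A hA M N (A i) hMd
  have l1 := bnd_lower (E := E) hp0 hp1' A hA M N (A i) hMd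
  have u2 := bnd_upper (E := E) hp0 hp1' A hA M N ∅ (fun k _ => Finset.disjoint_empty_right _)
  have l2 := bnd_lower (E := E) hp0 hp1' A hA M N ∅ (fun k _ => Finset.disjoint_empty_right _)
  rw [hJ] at u1 l1 u2 l2
  simp only [Finset.sdiff_empty] at u2 l2
  have hQ : 0 < qf E p A M ∅ := lt_of_lt_of_le hq
    (qf_anti (E := E) hp0 hp1' A (by rw [← hJ]; exact Finset.subset_union_left) ∅)
  have hqi0 := qf_nonneg (E := E) hp0 hp1' A J (A i)
  have hqi1 : qf E p A J (A i) ≤ qf E p A J ∅ :=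
    ex_mono hp0 hp1' fun G _ => Zf_anti A J (Finset.union_subset_union_right (Finset.empty_subset _))
  have hqM : qf E p A J ∅ ≤ qf E p A M ∅ :=
    qf_anti (E := E) hp0 hp1' A (by rw [← hJ]; exact Finset.subset_union_left) ∅
  set w := p ^ (A i).card with hw
  set β := ∑ j ∈ N, p ^ (A j \ A i).card with hβ
  set κ := ∑ j ∈ N, p ^ (A j).card with hκ
  set Q := qf E p A M ∅
  set q0 := qf E p A J ∅
  set q1 := qf E p A J (A i)
  have hw0 : 0 ≤ w := pow_nonneg hp0 _
  have hw1 : w ≤ 1/2 := by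
    calc w ≤ p ^ 1 := pow_le_pow_of_le_one hp0 hp1' hne.card_pos
      _ ≤ 1/2 := by simpa using hp1
  have hρ : q1 / q0 = (1 - (Q - q1) / Q) / (1 - (Q - q0) / Q) := by
    have a1 : 1 - (Q - q1) / Q = q1 / Q := by field_simp; ring
    have a2 : 1 - (Q - q0) / Q = q0 / Q := by field_simp; ring
    rw [a1, a2]
    field_simp
  have hwβ : w * β = ∑ j ∈ N, p ^ (A i ∪ A j).card := by
    rw [hβ, Finset.mul_sum]
    exact Finset.sum_congr rfl fun j _ => pow_mul_sdiff _ _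
  have hsum : ∑ j ∈ J, (p ^ (A i ∪ A j).card - w * p ^ (A j).card) = w * β - w * κ := by
    rw [← hJ, Finset.sum_union hJ', hwβ, hκ, Finset.mul_sum, ← Finset.sum_sub_distrib]
    rw [Finset.sum_eq_zero (s := M), zero_add]
    intro k hk
    rw [Finset.card_union_of_disjoint (hMd k hk).symm, pow_add, sub_self]
  have hRi : w * Rf p A M N (A i) ≤ D3 := by
    rw [hD3]
    unfold Rf
    rw [mul_add, Finset.mul_sum, Finset.mul_sum]
    refine add_le_add (Finset.sum_le_sum fun j _ => ?_) (Finset.sum_le_sum fun j _ => ?_) <;>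
    · rw [Finset.mul_sum]
      refine Finset.sum_le_sum fun k _ => ?_
      rw [pow_mul_sdiff]
  have hR0 : w * Rf p A M N ∅ ≤ D3 := by
    rw [hD3]
    unfold Rf
    rw [mul_add, Finset.mul_sum, Finset.mul_sum]
    refine add_le_add (Finset.sum_le_sum fun j _ => ?_) (Finset.sum_le_sum fun j _ => ?_) <;>
    · rw [Finset.mul_sum]
      refine Finset.sum_le_sum fun k _ => ?_
      rw [Finset.sdiff_empty]
      exact pow_mul_le hp0 hp1' _ _
  have hD3' : ∑ j ∈ N, ∑ k ∈ N.erase j, p ^ (A i ∪ (A j ∪ A k)).card ≤ D3 := by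
    rw [hD3]
    refine le_add_of_nonneg_right (Finset.sum_nonneg fun j _ => Finset.sum_nonneg fun k _ => ?_)
    positivity
  have hβκ : w * (β * κ) ≤ D3 + D2 := by
    have h1 : w * (β * κ) = ∑ j ∈ N, ∑ k ∈ N, p ^ (A i ∪ A j).card * p ^ (A k).card := by
      rw [← mul_assoc, hwβ, hκ, Finset.sum_mul_sum]
    rw [h1]
    have h2 : ∀ j ∈ N, ∑ k ∈ N, p ^ (A i ∪ A j).card * p ^ (A k).card
        ≤ (∑ k ∈ N.erase j, p ^ (A i ∪ (A j ∪ A k)).card)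
          + p ^ (A i ∪ A j).card * p ^ (A j).card := by
      intro j hj
      rw [← Finset.sum_erase_add _ _ hj]
      gcongr with k hk
      rw [← Finset.union_assoc]
      exact pow_mul_le hp0 hp1' _ _
    refine le_trans (Finset.sum_le_sum h2) ?_
    rw [Finset.sum_add_distrib, hD2]
    gcongr
  have hκβ : κ ≤ β := by
    rw [hκ, hβ]
    refine Finset.sum_le_sum fun j _ => ?_
    exact pow_le_pow_of_le_one hp0 hp1' (Finset.card_le_card Finset.sdiff_subset)
  have hκ0 : 0 ≤ κ := Finset.sum_nonneg fun j _ => pow_nonneg hp0 _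
  have hκ2 : w * κ ^ 2 ≤ D3 + D2 := by
    refine le_trans ?_ hβκ
    rw [sq]; gcongr
  have key := scalar_step (w := w) (b := (Q - q1) / Q) (c := (Q - q0) / Q) (β := β) (κ := κ)
    (R0 := Rf p A M N ∅) (Ri := Rf p A M N (A i)) (S := w * β) (D3 := D3) (D2 := D2) hw0 hw1
    (div_nonneg (by linarith) hQ.le) (by rw [div_le_one hQ]; linarith)
    (div_nonneg (by linarith) hQ.le) (by rw [div_lt_one hQ]; linarith)
    (by gcongr) (by rw [div_le_iff₀ hQ]; exact u1) (by rw [le_div_iff₀ hQ]; exact l1)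
    (by rw [div_le_iff₀ hQ]; exact u2) (by rw [le_div_iff₀ hQ]; exact l2)
    rfl hRi hR0 hκ2 hβκ
  rw [← hρ] at key
  have hins : qf E p A (insert i J) ∅ = q0 * (1 - w * (q1 / q0)) := by
    rw [qf_insert A hA J i]
    change q0 - w * q1 = _
    field_simp
  have hr1 : q1 / q0 ≤ 1 := by rw [div_le_one hq]; exact hqi1
  have hr0 : 0 ≤ q1 / q0 := div_nonneg hqi0 hq.le
  have hpos : 0 < 1 - w * (q1 / q0) := by nlinarith
  refine ⟨by rw [hins]; exact mul_pos hq hpos, ?_⟩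
  rw [hins, Real.log_mul hq.ne' hpos.ne', hsum]
  rw [show Real.log q0 + Real.log (1 - w * (q1 / q0)) - Real.log q0 - (-w + (w * β - w * κ))
    = Real.log (1 - w * (q1 / q0)) - (-w + (w * β - w * κ)) by ring]
  exact key

theorem janson {E : Finset α} {p : ℝ} (hp : 0 < p) (hp1 : p ≤ 1/2) (A : ι → Finset α)
    (hA : ∀ j, A j ⊆ E) (J : Finset ι) (hne : ∀ j ∈ J, (A j).Nonempty) :
    0 < qf E p A J ∅ ∧
    |Real.log (qf E p A J ∅) - LJ p A J| ≤ 3 * T3J p A J + 2 * T2J p A J + 2 * T1J p A J := by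
  induction J using Finset.induction_on with
  | empty =>
    have : qf E p A ∅ ∅ = 1 := by
      unfold qf Zf; simp [ex_one]
    rw [this]
    simp [LJ, T1J, T2J, T3J]
  | insert i J hi ih =>
    obtain ⟨hq, ih⟩ := ih fun j hj => hne j (Finset.mem_insert_of_mem hj)
    obtain ⟨hpos, hstep⟩ := janson_step hp hp1 A hA J i hi (hne i (Finset.mem_insert_self _ _)) hq
      _ _ rfl rfl _ _ rfl rfl
    refine ⟨hpos, ?_⟩
    have hp0 := hp.le
    set N := J.filter (fun j => ¬ Disjoint (A j) (A i)) with hN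
    set M := J.filter (fun j => Disjoint (A j) (A i)) with hM
    have hij : ∀ j ∈ J, i ≠ j := fun j hj h => hi (h ▸ hj)
    have hL : LJ p A (insert i J) = LJ p A J + (-p ^ (A i).card +
        ∑ j ∈ J, (p ^ (A i ∪ A j).card - p ^ (A i).card * p ^ (A j).card)) := by
      unfold LJ
      simp only [Finset.sum_insert hi, Finset.sum_add_distrib]
      have e1 : (∑ j ∈ J, if i ≠ j then p ^ (A i ∪ A j).card - p ^ (A i).card * p ^ (A j).card else 0)
          = ∑ j ∈ J, (p ^ (A i ∪ A j).card - p ^ (A i).card * p ^ (A j).card) :=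
        Finset.sum_congr rfl fun j hj => by rw [if_pos (hij j hj)]
      have e2 : (∑ j ∈ J, if j ≠ i then p ^ (A j ∪ A i).card - p ^ (A j).card * p ^ (A i).card else 0)
          = ∑ j ∈ J, (p ^ (A i ∪ A j).card - p ^ (A i).card * p ^ (A j).card) :=
        Finset.sum_congr rfl fun j hj => by
          rw [if_pos (hij j hj).symm, Finset.union_comm (A j), mul_comm (p ^ (A j).card)]
      rw [e1, e2]
      simp only [ne_eq, not_true, if_false]
      ring
    have h1 : T1J p A (insert i J) = T1J p A J + (p ^ (A i).card) ^ 2 := by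
      unfold T1J; rw [Finset.sum_insert hi]; ring
    have h2 : T2J p A J + ∑ j ∈ N, p ^ (A i ∪ A j).card * p ^ (A j).card ≤ T2J p A (insert i J) := by
      unfold T2J
      simp only [Finset.sum_insert hi, Finset.sum_add_distrib]
      have e1 : (∑ j ∈ J, if i ≠ j ∧ ¬ Disjoint (A j) (A i) then
          p ^ (A i ∪ A j).card * p ^ (A j).card else 0)
          = ∑ j ∈ N, p ^ (A i ∪ A j).card * p ^ (A j).card := by
        rw [hN, Finset.sum_filter]
        exact Finset.sum_congr rfl fun j hj => by simp [hij j hj]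
      rw [e1]
      have e2 : 0 ≤ ∑ j ∈ J, if j ≠ i ∧ ¬ Disjoint (A i) (A j) then
          p ^ (A j ∪ A i).card * p ^ (A i).card else 0 :=
        Finset.sum_nonneg fun j _ => by split_ifs <;> positivity
      have e3 : 0 ≤ if i ≠ i ∧ ¬ Disjoint (A i) (A i) then
          p ^ (A i ∪ A i).card * p ^ (A i).card else 0 := by split_ifs <;> positivity
      linarith
    have h3 : T3J p A J + ((∑ j ∈ N, ∑ k ∈ N.erase j, p ^ (A i ∪ (A j ∪ A k)).card)
      + ∑ j ∈ N, ∑ k ∈ M with ¬ Disjoint (A k) (A j), p ^ (A i ∪ (A j ∪ A k)).card)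
        ≤ T3J p A (insert i J) := by
      have hnn : ∀ i j k : ι, 0 ≤ if c3 A i j k then p ^ (A i ∪ A j ∪ A k).card else 0 := by
        intro i j k; split_ifs <;> positivity
      unfold T3J
      simp only [Finset.sum_insert hi, Finset.sum_add_distrib]
      have e1 : (∑ j ∈ N, ∑ k ∈ N.erase j, p ^ (A i ∪ (A j ∪ A k)).card)
          ≤ ∑ j ∈ J, ∑ k ∈ J, if c3 A j i k then p ^ (A j ∪ A i ∪ A k).card else 0 := by
        rw [hN, Finset.sum_filter]
        refine Finset.sum_le_sum fun j hj => ?_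
        by_cases hd : Disjoint (A j) (A i)
        · rw [if_neg (not_not.2 hd)]
          exact Finset.sum_nonneg fun k _ => hnn _ _ _
        · rw [if_pos hd, ← Finset.filter_ne', Finset.filter_filter, Finset.sum_filter]
          refine Finset.sum_le_sum fun k hk => ?_
          split_ifs with h4 h5 h5
          · rw [← Finset.union_assoc, Finset.union_comm (A i)]
          · exact absurd ⟨(hij j hj).symm, hij k hk, h4.2, hd, h4.1⟩ h5
          · positivity
          · exact le_rfl
      have e2 : (∑ j ∈ N, ∑ k ∈ M with ¬ Disjoint (A k) (A j), p ^ (A i ∪ (A j ∪ A k)).card)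
          ≤ ∑ j ∈ J, ∑ k ∈ J, if c3 A i j k then p ^ (A i ∪ A j ∪ A k).card else 0 := by
        rw [hN, Finset.sum_filter]
        refine Finset.sum_le_sum fun j hj => ?_
        by_cases hd : Disjoint (A j) (A i)
        · rw [if_neg (not_not.2 hd)]
          exact Finset.sum_nonneg fun k _ => hnn _ _ _
        · rw [if_pos hd, hM, Finset.filter_filter, Finset.sum_filter]
          refine Finset.sum_le_sum fun k hk => ?_
          split_ifs with h4 h5 h5
          · rw [Finset.union_assoc]
          · refine absurd ⟨hij j hj, ?_, (hij k hk).symm, fun h => hd h.symm, h4.2⟩ h5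
            rintro rfl
            exact hd h4.1
          · positivity
          · exact le_rfl
      have f1 := hnn i i i
      have f2 : 0 ≤ ∑ k ∈ J, if c3 A i i k then p ^ (A i ∪ A i ∪ A k).card else 0 :=
        Finset.sum_nonneg fun _ _ => hnn _ _ _
      have f3 : 0 ≤ ∑ j ∈ J, if c3 A i j i then p ^ (A i ∪ A j ∪ A i).card else 0 :=
        Finset.sum_nonneg fun _ _ => hnn _ _ _
      have f4 : 0 ≤ ∑ j ∈ J, if c3 A j i i then p ^ (A j ∪ A i ∪ A i).card else 0 :=
        Finset.sum_nonneg fun _ _ => hnn _ _ _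
      have f5 : 0 ≤ ∑ j ∈ J, ∑ k ∈ J, if c3 A j k i then p ^ (A j ∪ A k ∪ A i).card else 0 :=
        Finset.sum_nonneg fun _ _ => Finset.sum_nonneg fun _ _ => hnn _ _ _
      linarith
    rw [hL, h1]
    rw [abs_le] at ih hstep ⊢
    constructor <;> linarith [ih.1, ih.2, hstep.1, hstep.2]

end Janson2


open Finset
open scoped Classical
set_option linter.unusedSectionVars false

section Cliques
variable {n : ℕ}

/-- all `r`-subsets -/
def Vr (n r : ℕ) : Finset (Finset (Fin n)) := Finset.powersetCard r (Finset.univ : Finset (Fin n))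

/-- pairs inside `S` -/
def pr (S : Finset (Fin n)) : Finset (Finset (Fin n)) := Finset.powersetCard 2 S

def adj (S T : Finset (Fin n)) : Prop := S ≠ T ∧ 2 ≤ (S ∩ T).card

def ch (S T U : Finset (Fin n)) : Prop := adj S T ∧ adj U T ∧ S ≠ U

lemma adj_symm {S T : Finset (Fin n)} (h : adj S T) : adj T S :=
  ⟨h.1.symm, by rw [Finset.inter_comm]; exact h.2⟩

lemma adj_comm (S T : Finset (Fin n)) : adj S T ↔ adj T S := ⟨adj_symm, adj_symm⟩

lemma mem_Vr {r : ℕ} {S : Finset (Fin n)} : S ∈ Vr n r ↔ S.card = r := by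
  simp [Vr, Finset.mem_powersetCard]

lemma pr_sub (S : Finset (Fin n)) : pr S ⊆ pairsUniv n :=
  Finset.powersetCard_mono (Finset.subset_univ S)

lemma mem_pr {S e : Finset (Fin n)} : e ∈ pr S ↔ e ⊆ S ∧ e.card = 2 := Finset.mem_powersetCard

lemma pr_inter (S T : Finset (Fin n)) : pr S ∩ pr T = pr (S ∩ T) := by
  ext e; simp only [Finset.mem_inter, mem_pr, Finset.subset_inter_iff]; tauto

lemma card_pr (S : Finset (Fin n)) : (pr S).card = S.card.choose 2 := Finset.card_powersetCard 2 S

lemma adj_of_not_disjoint {S T : Finset (Fin n)} (hne : S ≠ T) (h : ¬ Disjoint (pr S) (pr T)) :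
    adj S T := by
  refine ⟨hne, ?_⟩
  rw [Finset.not_disjoint_iff] at h
  obtain ⟨e, h1, h2⟩ := h
  have : e ∈ pr (S ∩ T) := by rw [← pr_inter]; exact Finset.mem_inter.2 ⟨h1, h2⟩
  rw [mem_pr] at this
  rw [← this.2]; exact Finset.card_le_card this.1

lemma card_sdiff_pr {r : ℕ} {S T : Finset (Fin n)} (hS : S.card = r) :
    (pr S \ pr T).card = r.choose 2 - (S ∩ T).card.choose 2 := by
  have := Finset.card_sdiff_add_card_inter (pr S) (pr T)
  rw [pr_inter, card_pr, card_pr, hS] at this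
  omega

lemma inter_lt {r : ℕ} {S T : Finset (Fin n)} (hS : S.card = r) (hT : T.card = r) (h : S ≠ T) :
    (S ∩ T).card ≤ r - 1 := by
  by_contra hc
  have h1 : (S ∩ T).card ≤ r := hS ▸ Finset.card_le_card Finset.inter_subset_left
  have h2 : (S ∩ T).card = r := by omega
  have h3 : S ∩ T = S := Finset.eq_of_subset_of_card_le Finset.inter_subset_left (by omega)
  have h4 : S ∩ T = T := Finset.eq_of_subset_of_card_le Finset.inter_subset_right (by omega)
  exact h (h3.symm.trans h4)

/-- a clique misses at least `r-1` edges of an adjacent one -/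
lemma card_sdiff_ge {r : ℕ} (hr : 1 ≤ r) {S T : Finset (Fin n)} (hS : S.card = r) (hT : T.card = r)
    (h : S ≠ T) : r - 1 ≤ (pr S \ pr T).card := by
  rw [card_sdiff_pr hS]
  have h1 := inter_lt hS hT h
  have h2 : (S ∩ T).card.choose 2 ≤ (r - 1).choose 2 := Nat.choose_le_choose 2 h1
  obtain ⟨m, rfl⟩ : ∃ m, r = m + 1 := ⟨r - 1, by omega⟩
  have h3 : (m + 1).choose 2 = m + m.choose 2 := by
    rw [Nat.choose_succ_succ' m 1, Nat.choose_one_right]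
  simp only [Nat.add_sub_cancel] at *
  omega

lemma mem_cliqueHyp {r : ℕ} {G : Finset (Finset (Fin n))} {S : Finset (Fin n)} :
    S ∈ cliqueHyp n r G ↔ S ∈ Vr n r ∧ pr S ⊆ G := by
  simp [cliqueHyp, Vr, pr]

lemma cliqueHyp_sub {r : ℕ} {G : Finset (Finset (Fin n))} : cliqueHyp n r G ⊆ Vr n r :=
  fun _ h => (mem_cliqueHyp.1 h).1

/-- remaining edges -/
def Af (H : Finset (Finset (Fin n))) (S : Finset (Fin n)) : Finset (Finset (Fin n)) :=
  pr S \ hypGraph n H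

lemma mem_hypGraph {H : Finset (Finset (Fin n))} {e : Finset (Fin n)} :
    e ∈ hypGraph n H ↔ ∃ h ∈ H, e ∈ pr h := by
  simp only [hypGraph, Finset.mem_filter, mem_pr, pairsUniv, Finset.mem_powersetCard]
  constructor
  · rintro ⟨⟨_, h2⟩, h, hh, hs⟩; exact ⟨h, hh, hs, h2⟩
  · rintro ⟨h, hh, hs, h2⟩; exact ⟨⟨Finset.subset_univ _, h2⟩, h, hh, hs⟩

lemma Af_sub (H : Finset (Finset (Fin n))) (S : Finset (Fin n)) : Af H S ⊆ pairsUniv n :=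
  Finset.sdiff_subset.trans (pr_sub S)

lemma hypGraph_sub {r : ℕ} {G : Finset (Finset (Fin n))} : hypGraph n (cliqueHyp n r G) ⊆ G := by
  intro e he
  obtain ⟨h, hh, he⟩ := mem_hypGraph.1 he
  exact (mem_cliqueHyp.1 hh).2 he

lemma Af_nonempty {r : ℕ} {G : Finset (Finset (Fin n))} {S : Finset (Fin n)} (hS : S ∈ Vr n r)
    (hS' : S ∉ cliqueHyp n r G) : (Af (cliqueHyp n r G) S).Nonempty := by
  rw [Finset.nonempty_iff_ne_empty]
  intro h
  rw [Af, Finset.sdiff_eq_empty_iff_subset] at h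
  exact hS' (mem_cliqueHyp.2 ⟨hS, h.trans hypGraph_sub⟩)

/-- probability that the clique hypergraph is `H` -/
lemma prob_eq {r : ℕ} {p : ℝ} {H : Finset (Finset (Fin n))} (hH : H ⊆ Vr n r) :
    gnpProb n p {G | cliqueHyp n r G = H}
      = p ^ (hypGraph n H).card * qf (pairsUniv n) p (Af H) (Vr n r \ H) ∅ := by
  have h1 : gnpProb n p {G | cliqueHyp n r G = H}
      = ex (pairsUniv n) p (fun G => if cliqueHyp n r G = H then 1 else 0) := by
    unfold gnpProb ex
    rw [Finset.sum_filter]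
    refine Finset.sum_congr rfl fun G _ => ?_
    simp only [Set.mem_setOf_eq]
    split_ifs <;> simp
  have hsub : hypGraph n H ⊆ pairsUniv n := Finset.filter_subset _ _
  have h2 := ex_incl hsub p (fun G => if ∀ S ∈ Vr n r \ H, ¬ pr S ⊆ G then (1:ℝ) else 0)
  rw [h1]
  unfold qf
  have h3 : ∀ G : Finset (Finset (Fin n)),
      (if ∀ S ∈ Vr n r \ H, ¬ pr S ⊆ G ∪ hypGraph n H then (1:ℝ) else 0)
        = Zf (Af H) (Vr n r \ H) (G ∪ ∅) := by
    intro G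
    unfold Zf
    simp only [sub_union_iff, Af, Finset.sdiff_empty]
  simp only [h3] at h2
  rw [← h2]
  refine ex_congr fun G _ => ?_
  have h4 : cliqueHyp n r G = H ↔ hypGraph n H ⊆ G ∧ ∀ S ∈ Vr n r \ H, ¬ pr S ⊆ G := by
    constructor
    · rintro rfl
      refine ⟨hypGraph_sub, fun S hS hs => ?_⟩
      rw [Finset.mem_sdiff] at hS
      exact hS.2 (mem_cliqueHyp.2 ⟨hS.1, hs⟩)
    · rintro ⟨a, b⟩
      ext S
      rw [mem_cliqueHyp]
      constructor
      · rintro ⟨h5, h6⟩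
        by_contra h7
        exact b S (Finset.mem_sdiff.2 ⟨h5, h7⟩) h6
      · intro hS
        exact ⟨hH hS, fun e he => a (mem_hypGraph.2 ⟨S, hS, he⟩)⟩
  by_cases h5 : hypGraph n H ⊆ G
  · by_cases h6 : ∀ S ∈ Vr n r \ H, ¬ pr S ⊆ G
    · rw [if_pos (h4.2 ⟨h5, h6⟩), if_pos h5, if_pos h6]
    · rw [if_neg (fun h => h6 (h4.1 h).2), if_pos h5, if_neg h6]
  · rw [if_neg (fun h => h5 (h4.1 h).1), if_neg h5]

/-- cliques of `H` adjacent to `S` -/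
noncomputable def Xf (H : Finset (Finset (Fin n))) (S : Finset (Fin n)) : Finset (Finset (Fin n)) :=
  H.filter (fun h => adj h S)

lemma exists_adj {H : Finset (Finset (Fin n))} {S e : Finset (Fin n)} (hS : S ∉ H) (he : e ∈ pr S)
    (he' : e ∈ hypGraph n H) : ∃ h ∈ Xf H S, e ∈ pr h := by
  obtain ⟨h, hh, heh⟩ := mem_hypGraph.1 he'
  refine ⟨h, Finset.mem_filter.2 ⟨hh, adj_of_not_disjoint ?_ ?_⟩, heh⟩
  · rintro rfl; exact hS hh
  · rw [Finset.not_disjoint_iff]; exact ⟨e, heh, he⟩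

lemma Af_empty {H : Finset (Finset (Fin n))} {S : Finset (Fin n)} (hS : S ∉ H) (hX : Xf H S = ∅) :
    Af H S = pr S := by
  rw [Af, Finset.sdiff_eq_self_iff_disjoint, Finset.disjoint_left]
  intro e he he'
  obtain ⟨h, hh, _⟩ := exists_adj hS he he'
  rw [hX] at hh
  exact absurd hh (Finset.notMem_empty _)

lemma Af_single {H : Finset (Finset (Fin n))} {S h : Finset (Fin n)} (hS : S ∉ H) (hX : Xf H S = {h}) :
    Af H S = pr S \ pr h := by
  ext e
  simp only [Af, Finset.mem_sdiff]
  refine and_congr_right fun he => not_congr ⟨fun he' => ?_, fun he' => ?_⟩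
  · obtain ⟨h', hh, he2⟩ := exists_adj hS he he'
    rw [hX, Finset.mem_singleton] at hh
    exact hh ▸ he2
  · have : h ∈ Xf H S := by rw [hX]; exact Finset.mem_singleton_self h
    exact mem_hypGraph.2 ⟨h, (Finset.mem_filter.1 this).1, he'⟩

lemma Af_sub_sdiff {H : Finset (Finset (Fin n))} {S h : Finset (Fin n)} (hh : h ∈ H) :
    Af H S ⊆ pr S \ pr h := by
  intro e he
  rw [Af, Finset.mem_sdiff] at he
  exact Finset.mem_sdiff.2 ⟨he.1, fun h2 => he.2 (mem_hypGraph.2 ⟨h, hh, h2⟩)⟩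

lemma sdiff_sub_Af {r : ℕ} {G : Finset (Finset (Fin n))} {S : Finset (Fin n)} :
    pr S \ G ⊆ Af (cliqueHyp n r G) S :=
  Finset.sdiff_subset_sdiff (Finset.Subset.refl _) hypGraph_sub

end Cliques


open Finset
open scoped Classical
set_option linter.unusedSectionVars false

section Pointwise

noncomputable def Y1 (n r : ℕ) (p : ℝ) (G : Finset (Finset (Fin n))) : ℝ :=
  ∑ S ∈ Vr n r, ∑ T ∈ Vr n r, ∑ U ∈ Vr n r,
    if ch S T U then (if pr S ∪ pr U ⊆ G then p ^ (pr T \ G).card else 0) else 0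

noncomputable def Y2 (n r : ℕ) (p : ℝ) (G : Finset (Finset (Fin n))) : ℝ :=
  ∑ S ∈ Vr n r, ∑ T ∈ Vr n r, ∑ U ∈ Vr n r,
    if ch S T U then (if pr S ⊆ G then p ^ ((pr T ∪ pr U) \ G).card else 0) else 0

noncomputable def Y3 (n r : ℕ) (p : ℝ) (G : Finset (Finset (Fin n))) : ℝ :=
  ∑ S ∈ Vr n r, ∑ T ∈ Vr n r, ∑ U ∈ Vr n r,
    if ch S T U then p ^ ((pr S ∪ pr T ∪ pr U) \ G).card else 0

noncomputable def Y5 (n r : ℕ) (p : ℝ) (G : Finset (Finset (Fin n))) : ℝ :=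
  ∑ S ∈ Vr n r, ∑ T ∈ Vr n r,
    if adj S T then (if pr S ⊆ G then p ^ (pr T \ G).card else 0) else 0

noncomputable def Y6 (n r : ℕ) (p : ℝ) (G : Finset (Finset (Fin n))) : ℝ :=
  ∑ S ∈ Vr n r, ∑ T ∈ Vr n r,
    if adj S T then p ^ ((pr S ∪ pr T) \ G).card else 0

variable {n r : ℕ} {p : ℝ} {G : Finset (Finset (Fin n))}

lemma powle (hp : 0 ≤ p) (hp1 : p ≤ 1) {α : Type*} {B C : Finset α} (h : B ⊆ C) :
    p ^ C.card ≤ p ^ B.card := pow_le_pow_of_le_one hp hp1 (Finset.card_le_card h)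

lemma Xf_eq (S : Finset (Fin n)) :
    Xf (cliqueHyp n r G) S = (Vr n r).filter (fun h => pr h ⊆ G ∧ adj h S) := by
  ext h
  simp only [Xf, Finset.mem_filter, mem_cliqueHyp, and_assoc]

/-- sum over pairs of neighbours, as a sum with indicator -/
lemma pair_sum (T : Finset (Fin n)) (c : ℝ) :
    ∑ S ∈ Xf (cliqueHyp n r G) T, ∑ _U ∈ (Xf (cliqueHyp n r G) T).erase S, c
      = ∑ S ∈ Vr n r, ∑ U ∈ Vr n r,
        if ch S T U then (if pr S ∪ pr U ⊆ G then c else 0) else 0 := by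
  simp only [Xf_eq, ← Finset.filter_ne', Finset.filter_filter]
  rw [Finset.sum_filter]
  refine Finset.sum_congr rfl fun S _ => ?_
  by_cases h : pr S ⊆ G ∧ adj S T
  · rw [if_pos h, Finset.sum_filter]
    refine Finset.sum_congr rfl fun U _ => ?_
    by_cases h2 : (pr U ⊆ G ∧ adj U T) ∧ U ≠ S
    · rw [if_pos h2, if_pos ⟨h.2, h2.1.2, h2.2.symm⟩, if_pos (Finset.union_subset h.1 h2.1.1)]
    · rw [if_neg h2]
      split_ifs with h3 h4
      · exact absurd ⟨⟨(Finset.union_subset_iff.1 h4).2, h3.2.1⟩, h3.2.2.symm⟩ h2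
      · rfl
      · rfl
  · rw [if_neg h]
    symm
    refine Finset.sum_eq_zero fun U _ => ?_
    split_ifs with h3 h4
    · exact absurd ⟨(Finset.union_subset_iff.1 h4).1, h3.1⟩ h
    · rfl
    · rfl

lemma Y1_eq : Y1 n r p G = ∑ T ∈ Vr n r, ∑ S ∈ Xf (cliqueHyp n r G) T,
    ∑ _U ∈ (Xf (cliqueHyp n r G) T).erase S, p ^ (pr T \ G).card := by
  unfold Y1
  rw [Finset.sum_comm]
  exact Finset.sum_congr rfl fun T _ => (pair_sum T _).symm

lemma Y5_eq : Y5 n r p G = ∑ T ∈ Vr n r, ∑ _S ∈ Xf (cliqueHyp n r G) T, p ^ (pr T \ G).card := by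
  unfold Y5
  rw [Finset.sum_comm]
  refine Finset.sum_congr rfl fun T _ => ?_
  rw [Xf_eq, Finset.sum_filter]
  refine Finset.sum_congr rfl fun S _ => ?_
  by_cases h : adj S T <;> by_cases h2 : pr S ⊆ G <;> simp [h, h2]

lemma sum_le_pairs {β : Type*} [DecidableEq β] (X : Finset β) (hX : 2 ≤ X.card) {c : ℝ}
    (hc : 0 ≤ c) : ∑ _h ∈ X, c ≤ ∑ h ∈ X, ∑ _k ∈ X.erase h, c := by
  refine Finset.sum_le_sum fun h hh => ?_
  have : 1 ≤ (X.erase h).card := by rw [Finset.card_erase_of_mem hh]; omega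
  rw [Finset.sum_const, nsmul_eq_mul]
  have : (1:ℝ) ≤ ((X.erase h).card : ℝ) := by exact_mod_cast this
  nlinarith

lemma one_le_sum {β : Type*} (X : Finset β) (hX : 1 ≤ X.card) {c : ℝ}
    (hc : 0 ≤ c) : c ≤ ∑ _h ∈ X, c := by
  rw [Finset.sum_const, nsmul_eq_mul]
  have : (1:ℝ) ≤ (X.card : ℝ) := by exact_mod_cast hX
  nlinarith

lemma q_le (hp : 0 ≤ p) (hp1 : p ≤ 1) (S : Finset (Fin n)) :
    p ^ (Af (cliqueHyp n r G) S).card ≤ p ^ (pr S \ G).card := powle hp hp1 sdiff_sub_Af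

lemma pr_pow {S : Finset (Fin n)} (hS : S ∈ Vr n r) : p ^ (pr S).card = p ^ r.choose 2 := by
  rw [card_pr, mem_Vr.1 hS]

lemma Y1_nonneg (hp : 0 ≤ p) : 0 ≤ Y1 n r p G := by
  rw [Y1_eq]
  exact Finset.sum_nonneg fun _ _ => Finset.sum_nonneg fun _ _ => Finset.sum_nonneg fun _ _ => by positivity

/-- first-order term -/
lemma PA (hr : 1 ≤ r) (hp : 0 ≤ p) (hp1 : p ≤ 1) (H : Finset (Finset (Fin n)))
    (hH : H = cliqueHyp n r G) :
    |(∑ S ∈ Vr n r \ H, p ^ (Af H S).card)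
      - (∑ _S ∈ Vr n r \ H, p ^ r.choose 2 + ∑ h ∈ H, ∑ S ∈ Vr n r with adj h S,
          (p ^ (pr S \ pr h).card - p ^ r.choose 2))| ≤ 2 * Y1 n r p G + p ^ (r - 1) * Y5 n r p G := by
  have hHV : H ⊆ Vr n r := hH ▸ cliqueHyp_sub
  have hsw : ∑ h ∈ H, ∑ S ∈ Vr n r with adj h S, (p ^ (pr S \ pr h).card - p ^ r.choose 2)
      = ∑ S ∈ Vr n r, ∑ h ∈ Xf H S, (p ^ (pr S \ pr h).card - p ^ r.choose 2) := by
    unfold Xf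
    simp only [Finset.sum_filter]
    exact Finset.sum_comm
  have ht0 : ∀ S ∈ Vr n r, ∀ h, 0 ≤ p ^ (pr S \ pr h).card - p ^ r.choose 2 := by
    intro S hS h
    rw [← pr_pow hS, sub_nonneg]
    exact powle hp hp1 Finset.sdiff_subset
  have hπ : 0 ≤ p ^ r.choose 2 := pow_nonneg hp _
  rw [hsw, ← Finset.sum_sdiff hHV, ← add_assoc, ← Finset.sum_add_distrib, ← sub_sub,
    ← Finset.sum_sub_distrib]
  have hfirst : |∑ S ∈ Vr n r \ H, (p ^ (Af H S).card - (p ^ r.choose 2 +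
      ∑ h ∈ Xf H S, (p ^ (pr S \ pr h).card - p ^ r.choose 2)))| ≤ 2 * Y1 n r p G := by
    refine (Finset.abs_sum_le_sum_abs _ _).trans ?_
    rw [Y1_eq, ← hH, ← Finset.sum_sdiff hHV, mul_add]
    refine le_add_of_le_of_nonneg ?_ ?_
    · rw [Finset.mul_sum]
      refine Finset.sum_le_sum fun S hS => ?_
      obtain ⟨hSV, hSH⟩ := Finset.mem_sdiff.1 hS
      have hc0 : 0 ≤ p ^ (pr S \ G).card := pow_nonneg hp _
      have hss : 0 ≤ ∑ S_1 ∈ Xf H S, ∑ _U ∈ (Xf H S).erase S_1, p ^ (pr S \ G).card :=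
        Finset.sum_nonneg fun _ _ => Finset.sum_nonneg fun _ _ => hc0
      rcases Nat.lt_or_ge (Xf H S).card 2 with hlt | hge
      · refine le_trans (le_of_eq ?_) (mul_nonneg zero_le_two hss)
        rw [abs_eq_zero]
        rcases Nat.lt_or_ge (Xf H S).card 1 with h0 | h1
        · have hX : Xf H S = ∅ := Finset.card_eq_zero.1 (by omega)
          rw [Af_empty hSH hX, hX, pr_pow hSV]; simp
        · obtain ⟨h, hX⟩ := Finset.card_eq_one.1 (by omega : (Xf H S).card = 1)
          rw [Af_single hSH hX, hX]; simp
      · have k1 := sum_le_pairs (Xf H S) hge hc0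
        have k2 := one_le_sum (Xf H S) (by omega) hc0
        have hq : p ^ (Af H S).card ≤ p ^ (pr S \ G).card := by rw [hH]; exact q_le hp hp1 S
        have hq2 : p ^ r.choose 2 ≤ p ^ (Af H S).card := by
          rw [← pr_pow hSV]; exact powle hp hp1 Finset.sdiff_subset
        have k3 : ∑ h ∈ Xf H S, (p ^ (pr S \ pr h).card - p ^ r.choose 2)
            ≤ ∑ _h ∈ Xf H S, p ^ (pr S \ G).card := by
          refine Finset.sum_le_sum fun h hh => ?_
          have : p ^ (pr S \ pr h).card ≤ p ^ (Af H S).card :=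
            powle hp hp1 (Af_sub_sdiff (Finset.mem_filter.1 hh).1)
          linarith
        have k4 : 0 ≤ ∑ h ∈ Xf H S, (p ^ (pr S \ pr h).card - p ^ r.choose 2) :=
          Finset.sum_nonneg fun h _ => ht0 S hSV h
        rw [abs_le]
        constructor <;> linarith
    · exact mul_nonneg zero_le_two (Finset.sum_nonneg fun _ _ => Finset.sum_nonneg fun _ _ =>
        Finset.sum_nonneg fun _ _ => pow_nonneg hp _)
  have hsecond0 : 0 ≤ ∑ S ∈ H, ∑ h ∈ Xf H S, (p ^ (pr S \ pr h).card - p ^ r.choose 2) :=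
    Finset.sum_nonneg fun S hS => Finset.sum_nonneg fun h _ => ht0 S (hHV hS) h
  have hsecond : ∑ S ∈ H, ∑ h ∈ Xf H S, (p ^ (pr S \ pr h).card - p ^ r.choose 2)
      ≤ p ^ (r - 1) * Y5 n r p G := by
    rw [Y5_eq, ← hH, ← Finset.sum_sdiff hHV, mul_add]
    refine le_add_of_nonneg_of_le ?_ ?_
    · exact mul_nonneg (pow_nonneg hp _) (Finset.sum_nonneg fun _ _ => Finset.sum_nonneg fun _ _ =>
        pow_nonneg hp _)
    · rw [Finset.mul_sum]
      refine Finset.sum_le_sum fun S hS => ?_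
      rw [Finset.mul_sum]
      refine Finset.sum_le_sum fun h hh => ?_
      have hSG : pr S ⊆ G := by rw [hH] at hS; exact (mem_cliqueHyp.1 hS).2
      rw [Finset.sdiff_eq_empty_iff_subset.2 hSG, Finset.card_empty, pow_zero, mul_one]
      obtain ⟨hhH, hadj⟩ := Finset.mem_filter.1 hh
      have : p ^ (pr S \ pr h).card ≤ p ^ (r - 1) := pow_le_pow_of_le_one hp hp1
        (card_sdiff_ge hr (mem_Vr.1 (hHV hS)) (mem_Vr.1 (hHV hhH)) hadj.1.symm)
      linarith
  rw [abs_le] at hfirst ⊢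
  constructor <;> linarith [hfirst.1, hfirst.2]

lemma choose_ge (r : ℕ) (hr : 1 ≤ r) : r - 1 ≤ r.choose 2 := by
  obtain ⟨m, rfl⟩ : ∃ m, r = m + 1 := ⟨r - 1, by omega⟩
  rw [Nat.choose_succ_succ' m 1, Nat.choose_one_right]; simp

/-- auxiliary summand -/
noncomputable def aux (r : ℕ) (p : ℝ) (G : Finset (Finset (Fin n))) (S T : Finset (Fin n)) : ℝ :=
  p ^ (r - 1) * (if adj S T then (if pr S ⊆ G then p ^ (pr T \ G).card else 0) else 0)
    + ∑ h ∈ Vr n r, if ch h S T then (if pr h ⊆ G then p ^ ((pr S ∪ pr T) \ G).card else 0) else 0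

lemma aux_nonneg (hp : 0 ≤ p) (S T : Finset (Fin n)) : 0 ≤ aux r p G S T := by
  unfold aux
  refine add_nonneg (mul_nonneg (pow_nonneg hp _) ?_) (Finset.sum_nonneg fun h _ => ?_)
  · split_ifs <;> positivity
  · split_ifs <;> positivity

lemma aux_sum : ∑ S ∈ Vr n r, ∑ T ∈ Vr n r, aux r p G S T = p ^ (r - 1) * Y5 n r p G + Y2 n r p G := by
  unfold aux Y5 Y2
  simp only [Finset.sum_add_distrib, Finset.mul_sum]
  congr 1
  rw [Finset.sum_comm' (t' := Vr n r) (s' := fun _ => Vr n r) (by simp)]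
  rw [Finset.sum_comm]
  rw [Finset.sum_comm]
  conv_rhs => rw [Finset.sum_comm]
  rw [Finset.sum_comm]
  refine Finset.sum_congr rfl fun T _ => ?_
  rw [Finset.sum_comm]

end Pointwise


open Finset
open scoped Classical
set_option linter.unusedSectionVars false

section Pointwise2
variable {n r : ℕ} {p : ℝ} {G : Finset (Finset (Fin n))}

lemma aux_ge1 (hp : 0 ≤ p) {S T : Finset (Fin n)} (h : adj S T) (hS : pr S ⊆ G) :
    p ^ (r - 1) * p ^ (pr T \ G).card ≤ aux r p G S T := by
  unfold aux
  rw [if_pos h, if_pos hS]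
  refine le_add_of_nonneg_right (Finset.sum_nonneg fun h _ => ?_)
  split_ifs <;> positivity

lemma aux_ge2 (hp : 0 ≤ p) {S T h : Finset (Fin n)} (hV : h ∈ Vr n r) (hc : ch h S T) (hh : pr h ⊆ G) :
    p ^ ((pr S ∪ pr T) \ G).card ≤ aux r p G S T := by
  unfold aux
  refine le_add_of_nonneg_of_le ?_ ?_
  · refine mul_nonneg (pow_nonneg hp _) ?_
    split_ifs <;> positivity
  · refine le_trans (le_of_eq ?_) (Finset.single_le_sum (fun h _ => ?_) hV)
    · rw [if_pos hc, if_pos hh]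
    · split_ifs <;> positivity

lemma disj_of_not_adj {S T : Finset (Fin n)} (hne : S ≠ T) (h : ¬ adj S T) : Disjoint (pr S) (pr T) := by
  by_contra hd
  exact h (adj_of_not_disjoint hne hd)

lemma union_Af (H : Finset (Finset (Fin n))) (S T : Finset (Fin n)) :
    Af H S ∪ Af H T = (pr S ∪ pr T) \ hypGraph n H := by
  unfold Af; rw [Finset.union_sdiff_distrib]

lemma qST_le (hp : 0 ≤ p) (hp1 : p ≤ 1) (S T : Finset (Fin n)) :
    p ^ (Af (cliqueHyp n r G) S ∪ Af (cliqueHyp n r G) T).card ≤ p ^ ((pr S ∪ pr T) \ G).card := by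
  rw [union_Af]
  exact powle hp hp1 (Finset.sdiff_subset_sdiff (Finset.Subset.refl _) hypGraph_sub)

noncomputable def f2 (p : ℝ) (H : Finset (Finset (Fin n))) (S T : Finset (Fin n)) : ℝ :=
  if S ≠ T then p ^ (Af H S ∪ Af H T).card - p ^ (Af H S).card * p ^ (Af H T).card else 0

noncomputable def g2 (r : ℕ) (p : ℝ) (S T : Finset (Fin n)) : ℝ :=
  if adj S T then p ^ (pr S ∪ pr T).card - p ^ r.choose 2 * p ^ r.choose 2 else 0

lemma f2_comm (H : Finset (Finset (Fin n))) (S T : Finset (Fin n)) : f2 p H S T = f2 p H T S := by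
  unfold f2
  rw [Finset.union_comm, mul_comm]
  simp only [ne_comm]

lemma g2_comm (S T : Finset (Fin n)) : g2 r p S T = g2 r p T S := by
  unfold g2
  rw [Finset.union_comm]
  simp only [adj_comm S T]

lemma g2_nonneg (hp : 0 ≤ p) (hp1 : p ≤ 1) {S T : Finset (Fin n)} (hS : S ∈ Vr n r) (hT : T ∈ Vr n r) :
    0 ≤ g2 r p S T := by
  unfold g2
  split_ifs with h
  · rw [sub_nonneg]
    have := pow_mul_le hp hp1 (pr S) (pr T)
    rwa [pr_pow hS, pr_pow hT] at this
  · exact le_rfl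

lemma g2_le (hp : 0 ≤ p) {S T : Finset (Fin n)} (h : adj S T) : g2 r p S T ≤ p ^ (pr S ∪ pr T).card := by
  unfold g2
  rw [if_pos h]
  have : 0 ≤ p ^ r.choose 2 * p ^ r.choose 2 := by positivity
  linarith

lemma g2_H (hr : 1 ≤ r) (hp : 0 ≤ p) (hp1 : p ≤ 1) {S T : Finset (Fin n)} (hS : S ∈ Vr n r)
    (hSG : pr S ⊆ G) : g2 r p S T ≤ aux r p G S T := by
  by_cases h : adj S T
  · refine (g2_le hp h).trans (le_trans ?_ (aux_ge1 hp h hSG))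
    rw [← pow_mul_sdiff, pr_pow hS]
    refine mul_le_mul (pow_le_pow_of_le_one hp hp1 (choose_ge r hr)) ?_ (by positivity) (by positivity)
    exact powle hp hp1 (Finset.sdiff_subset_sdiff (Finset.Subset.refl _) hSG)
  · unfold g2; rw [if_neg h]; exact aux_nonneg hp S T

lemma fg_X (hp : 0 ≤ p) (hp1 : p ≤ 1) {S T h : Finset (Fin n)} (hS : S ∈ Vr n r) (hT : T ∈ Vr n r)
    (hne : S ≠ T) (hTH : T ∉ cliqueHyp n r G) (hh : h ∈ Xf (cliqueHyp n r G) S) :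
    |f2 p (cliqueHyp n r G) S T - g2 r p S T| ≤ aux r p G S T := by
  obtain ⟨hhH, hadj⟩ := Finset.mem_filter.1 hh
  by_cases hST : adj S T
  · have h1 := aux_ge2 (G := G) (S := S) (T := T) hp (mem_cliqueHyp.1 hhH).1
      ⟨hadj, adj_symm hST, by rintro rfl; exact hTH hhH⟩ (mem_cliqueHyp.1 hhH).2
    have h2 := qST_le (r := r) (G := G) hp hp1 S T
    have h3 := g2_nonneg hp hp1 hS hT
    have h4 := g2_le (r := r) hp hST
    have h5 : p ^ (pr S ∪ pr T).card ≤ p ^ ((pr S ∪ pr T) \ G).card := powle hp hp1 Finset.sdiff_subset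
    have h6 := pow_mul_le hp hp1 (Af (cliqueHyp n r G) S) (Af (cliqueHyp n r G) T)
    have h7 : 0 ≤ p ^ (Af (cliqueHyp n r G) S).card * p ^ (Af (cliqueHyp n r G) T).card := by positivity
    have h8 : f2 p (cliqueHyp n r G) S T = p ^ (Af (cliqueHyp n r G) S ∪ Af (cliqueHyp n r G) T).card -
      p ^ (Af (cliqueHyp n r G) S).card * p ^ (Af (cliqueHyp n r G) T).card := if_pos hne
    rw [abs_le, h8]
    constructor <;> linarith
  · have hd := disj_of_not_adj hne hST
    have hd2 : Disjoint (Af (cliqueHyp n r G) S) (Af (cliqueHyp n r G) T) :=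
      hd.mono Finset.sdiff_subset Finset.sdiff_subset
    have h8 : f2 p (cliqueHyp n r G) S T = 0 := by
      unfold f2; rw [if_pos hne, Finset.card_union_of_disjoint hd2, pow_add, sub_self]
    have h9 : g2 r p S T = 0 := if_neg hST
    rw [h8, h9, sub_zero, abs_zero]
    exact aux_nonneg hp S T

lemma fg_bound (hr : 1 ≤ r) (hp : 0 ≤ p) (hp1 : p ≤ 1) {S T : Finset (Fin n)} (hS : S ∈ Vr n r)
    (hT : T ∈ Vr n r) :
    |(if S ∉ cliqueHyp n r G ∧ T ∉ cliqueHyp n r G then f2 p (cliqueHyp n r G) S T else 0)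
      - g2 r p S T| ≤ aux r p G S T + aux r p G T S := by
  have a1 := aux_nonneg (r := r) (G := G) hp S T
  have a2 := aux_nonneg (r := r) (G := G) hp T S
  have hg := g2_nonneg hp hp1 hS hT
  by_cases hSH : S ∈ cliqueHyp n r G
  · rw [if_neg (by tauto), zero_sub, abs_neg, abs_of_nonneg hg]
    have := g2_H (T := T) hr hp hp1 hS (mem_cliqueHyp.1 hSH).2
    linarith
  by_cases hTH : T ∈ cliqueHyp n r G
  · rw [if_neg (by tauto), zero_sub, abs_neg, abs_of_nonneg hg]
    have := g2_H (T := S) hr hp hp1 hT (mem_cliqueHyp.1 hTH).2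
    rw [g2_comm] at this
    linarith
  rw [if_pos ⟨hSH, hTH⟩]
  by_cases hne : S = T
  · subst hne
    have h1 : f2 p (cliqueHyp n r G) S S = 0 := if_neg (by simp)
    have h2 : g2 r p S S = 0 := if_neg (fun h => h.1 rfl)
    rw [h1, h2, sub_zero, abs_zero]; linarith
  rcases Finset.eq_empty_or_nonempty (Xf (cliqueHyp n r G) S) with hX | ⟨h, hh⟩
  · rcases Finset.eq_empty_or_nonempty (Xf (cliqueHyp n r G) T) with hY | ⟨h, hh⟩
    · have : f2 p (cliqueHyp n r G) S T = g2 r p S T := by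
        unfold f2 g2
        rw [if_pos hne, Af_empty hSH hX, Af_empty hTH hY]
        by_cases hST : adj S T
        · rw [if_pos hST, pr_pow hS, pr_pow hT]
        · rw [if_neg hST, Finset.card_union_of_disjoint (disj_of_not_adj hne hST), pow_add, sub_self]
      rw [this, sub_self, abs_zero]; linarith
    · have := fg_X hp hp1 hT hS (Ne.symm hne) hSH hh
      rw [f2_comm, g2_comm] at this
      linarith
  · have := fg_X hp hp1 hS hT hne hTH hh
    linarith

/-- second-order term -/
lemma PB (hr : 1 ≤ r) (hp : 0 ≤ p) (hp1 : p ≤ 1) (H : Finset (Finset (Fin n)))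
    (hH : H = cliqueHyp n r G) :
    |(1/2) * (∑ S ∈ Vr n r \ H, ∑ T ∈ Vr n r \ H, if S ≠ T then
        p ^ (Af H S ∪ Af H T).card - p ^ (Af H S).card * p ^ (Af H T).card else 0)
      - (1/2) * ∑ S ∈ Vr n r, ∑ T ∈ Vr n r, g2 r p S T| ≤ p ^ (r - 1) * Y5 n r p G + Y2 n r p G := by
  have h1 : (∑ S ∈ Vr n r \ H, ∑ T ∈ Vr n r \ H, if S ≠ T then
        p ^ (Af H S ∪ Af H T).card - p ^ (Af H S).card * p ^ (Af H T).card else 0)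
      = ∑ S ∈ Vr n r, ∑ T ∈ Vr n r, if S ∉ H ∧ T ∉ H then f2 p H S T else 0 := by
    rw [← Finset.filter_notMem_eq_sdiff, Finset.sum_filter]
    refine Finset.sum_congr rfl fun S _ => ?_
    by_cases hS : S ∉ H
    · rw [if_pos hS, Finset.sum_filter]
      refine Finset.sum_congr rfl fun T _ => ?_
      simp only [hS, not_false_eq_true, true_and, f2]
    · rw [if_neg hS]; symm
      refine Finset.sum_eq_zero fun T _ => ?_
      rw [if_neg (by tauto)]
  rw [h1, ← mul_sub, abs_mul, ← aux_sum, ← Finset.sum_sub_distrib]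
  simp only [← Finset.sum_sub_distrib]
  have h2 : |∑ S ∈ Vr n r, ∑ T ∈ Vr n r, ((if S ∉ H ∧ T ∉ H then f2 p H S T else 0) - g2 r p S T)|
      ≤ ∑ S ∈ Vr n r, ∑ T ∈ Vr n r, (aux r p G S T + aux r p G T S) := by
    refine (Finset.abs_sum_le_sum_abs _ _).trans (Finset.sum_le_sum fun S hS => ?_)
    refine (Finset.abs_sum_le_sum_abs _ _).trans (Finset.sum_le_sum fun T hT => ?_)
    rw [hH]
    exact fg_bound hr hp hp1 hS hT
  have h3 : ∑ S ∈ Vr n r, ∑ T ∈ Vr n r, (aux r p G S T + aux r p G T S)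
      = 2 * ∑ S ∈ Vr n r, ∑ T ∈ Vr n r, aux r p G S T := by
    simp only [Finset.sum_add_distrib]
    rw [Finset.sum_comm (f := fun S T => aux r p G T S)]; ring
  have : |(1/2:ℝ)| = 1/2 := by norm_num
  rw [this]; linarith

lemma T3J_le (hp : 0 ≤ p) (hp1 : p ≤ 1) (H : Finset (Finset (Fin n)))
    (hH : H = cliqueHyp n r G) : T3J p (Af H) (Vr n r \ H) ≤ Y3 n r p G := by
  unfold T3J Y3
  have hs : Vr n r \ H ⊆ Vr n r := Finset.sdiff_subset
  have nn : ∀ S T U : Finset (Fin n),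
    0 ≤ if ch S T U then p ^ ((pr S ∪ pr T ∪ pr U) \ G).card else 0 := by
      intro S T U; split_ifs <;> positivity
  refine le_trans (Finset.sum_le_sum fun S _ => ?_) (Finset.sum_le_sum_of_subset_of_nonneg hs
    fun S _ _ => Finset.sum_nonneg fun T _ => Finset.sum_nonneg fun U _ => nn S T U)
  refine le_trans (Finset.sum_le_sum fun T _ => ?_) (Finset.sum_le_sum_of_subset_of_nonneg hs
    fun T _ _ => Finset.sum_nonneg fun U _ => nn S T U)
  refine le_trans (Finset.sum_le_sum fun U _ => ?_) (Finset.sum_le_sum_of_subset_of_nonneg hs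
    fun U _ _ => nn S T U)
  by_cases hc : c3 (Af H) S T U
  · obtain ⟨h1, h2, h3, h4, h5⟩ := hc
    have e1 : adj S T := adj_of_not_disjoint h1 fun h => h4 (h.mono Finset.sdiff_subset Finset.sdiff_subset)
    have e2 : adj U T := adj_of_not_disjoint h2.symm fun h => h5 (h.mono Finset.sdiff_subset Finset.sdiff_subset)
    rw [if_pos ⟨h1, h2, h3, h4, h5⟩, if_pos ⟨e1, e2, h3.symm⟩]
    refine powle hp hp1 ?_
    rw [union_Af, Af, ← Finset.union_sdiff_distrib, hH]
    exact Finset.sdiff_subset_sdiff (Finset.Subset.refl _) hypGraph_sub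
  · rw [if_neg hc]; exact nn S T U

lemma T2J_le (hr : 1 ≤ r) (hp : 0 ≤ p) (hp1 : p ≤ 1) (H : Finset (Finset (Fin n)))
    (hH : H = cliqueHyp n r G) :
    T2J p (Af H) (Vr n r \ H) ≤ p ^ (r - 1) * Y6 n r p G + (p ^ (r - 1) * Y5 n r p G + Y2 n r p G) := by
  rw [← aux_sum]
  unfold T2J Y6
  rw [Finset.sum_comm, Finset.mul_sum, ← Finset.sum_add_distrib]
  have hs : Vr n r \ H ⊆ Vr n r := Finset.sdiff_subset
  simp only [Finset.mul_sum, ← Finset.sum_add_distrib]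
  have nn : ∀ S T : Finset (Fin n),
    0 ≤ p ^ (r - 1) * (if adj S T then p ^ ((pr S ∪ pr T) \ G).card else 0) + aux r p G S T := by
      intro S T
      have := aux_nonneg (r := r) (G := G) hp S T
      split_ifs <;> positivity
  refine le_trans (Finset.sum_le_sum fun S hS => ?_) (Finset.sum_le_sum_of_subset_of_nonneg hs
    fun S _ _ => Finset.sum_nonneg fun T _ => nn S T)
  refine le_trans (Finset.sum_le_sum fun T hT => ?_) (Finset.sum_le_sum_of_subset_of_nonneg hs
    fun T _ _ => nn S T)
  by_cases hc : T ≠ S ∧ ¬ Disjoint (Af H S) (Af H T)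
  · rw [if_pos hc]
    have hadj : adj S T := adj_of_not_disjoint hc.1.symm
      fun h => hc.2 (h.mono Finset.sdiff_subset Finset.sdiff_subset)
    rw [if_pos hadj]
    have h2 : p ^ (Af H T ∪ Af H S).card ≤ p ^ ((pr S ∪ pr T) \ G).card := by
      rw [Finset.union_comm, hH]; exact qST_le hp hp1 S T
    have hq0 : 0 ≤ p ^ (Af H S).card := by positivity
    have hq1 : p ^ (Af H S).card ≤ 1 := pow_le_one₀ hp hp1
    have hu0 : 0 ≤ p ^ (Af H T ∪ Af H S).card := by positivity
    have ha := aux_nonneg (r := r) (G := G) hp S T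
    rw [Finset.mem_sdiff] at hS hT
    rcases Finset.eq_empty_or_nonempty (Xf H S) with hX | ⟨h, hh⟩
    · rw [Af_empty hS.2 hX] at *
      rw [pr_pow hS.1] at *
      have h3 : p ^ r.choose 2 ≤ p ^ (r - 1) := pow_le_pow_of_le_one hp hp1 (choose_ge r hr)
      have h4 := mul_le_mul h3 h2 hu0 (pow_nonneg hp _)
      linarith
    · obtain ⟨hhH, hh2⟩ := Finset.mem_filter.1 hh
      have hhH' := mem_cliqueHyp.1 (hH ▸ hhH)
      have := aux_ge2 (G := G) (S := S) (T := T) hp hhH'.1 ⟨hh2, adj_symm hadj,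
        by rintro rfl; exact hT.2 hhH⟩ hhH'.2
      have h5 : 0 ≤ p ^ (r - 1) * p ^ ((pr S ∪ pr T) \ G).card := by positivity
      nlinarith
  · rw [if_neg hc]; exact nn S T

lemma T1J_le (hr : 1 ≤ r) (hp : 0 ≤ p) (hp1 : p ≤ 1) (H : Finset (Finset (Fin n)))
    (hH : H = cliqueHyp n r G) :
    T1J p (Af H) (Vr n r \ H) ≤ (n.choose r : ℝ) * (p ^ r.choose 2) ^ 2
      + p ^ (r - 1) * Y5 n r p G + Y1 n r p G := by
  have hN : (n.choose r : ℝ) * (p ^ r.choose 2) ^ 2 = ∑ S ∈ Vr n r, (p ^ r.choose 2) ^ 2 := by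
    rw [Finset.sum_const, nsmul_eq_mul, Vr, Finset.card_powersetCard, Finset.card_univ, Fintype.card_fin]
  rw [hN, Y5_eq, Y1_eq, ← hH, Finset.mul_sum, ← Finset.sum_add_distrib, ← Finset.sum_add_distrib]
  unfold T1J
  have n1 : ∀ S, 0 ≤ p ^ (r-1) * ∑ _h ∈ Xf H S, p ^ (pr S \ G).card := fun S =>
    mul_nonneg (pow_nonneg hp _) (Finset.sum_nonneg fun _ _ => pow_nonneg hp _)
  have n2 : ∀ S, 0 ≤ ∑ S_1 ∈ Xf H S, ∑ _U ∈ (Xf H S).erase S_1, p ^ (pr S \ G).card := fun S =>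
    Finset.sum_nonneg fun _ _ => Finset.sum_nonneg fun _ _ => pow_nonneg hp _
  have n0 : 0 ≤ (p ^ r.choose 2) ^ 2 := by positivity
  refine le_trans (Finset.sum_le_sum fun S hS => ?_) (Finset.sum_le_sum_of_subset_of_nonneg
    (Finset.sdiff_subset : Vr n r \ H ⊆ Vr n r) fun S _ _ => ?_)
  swap
  · have := n1 S; have := n2 S; positivity
  rw [Finset.mem_sdiff] at hS
  have m1 := n1 S
  have m2 := n2 S
  have hq : p ^ (Af H S).card ≤ p ^ (pr S \ G).card := by rw [hH]; exact q_le hp hp1 S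
  have hq0 : 0 ≤ p ^ (Af H S).card := by positivity
  have hq1 : p ^ (Af H S).card ≤ 1 := pow_le_one₀ hp hp1
  have hc0 : 0 ≤ p ^ (pr S \ G).card := pow_nonneg hp _
  rcases Nat.lt_or_ge (Xf H S).card 2 with hlt | hge
  · rcases Nat.lt_or_ge (Xf H S).card 1 with h0 | h1
    · have hX : Xf H S = ∅ := Finset.card_eq_zero.1 (by omega)
      rw [Af_empty hS.2 hX, pr_pow hS.1]; linarith
    · obtain ⟨h, hX⟩ := Finset.card_eq_one.1 (by omega : (Xf H S).card = 1)
      have k := one_le_sum (Xf H S) h1 hc0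
      have hhX : h ∈ Xf H S := by rw [hX]; exact Finset.mem_singleton_self h
      obtain ⟨hhH, hadj⟩ := Finset.mem_filter.1 hhX
      have hhV : h ∈ Vr n r := cliqueHyp_sub (hH ▸ hhH)
      have : p ^ (Af H S).card ≤ p ^ (r - 1) := by
        rw [Af_single hS.2 hX]
        exact pow_le_pow_of_le_one hp hp1 (card_sdiff_ge hr (mem_Vr.1 hS.1) (mem_Vr.1 hhV) hadj.1.symm)
      have h3 := mul_le_mul this (hq.trans k) hq0 (pow_nonneg hp _)
      nlinarith
  · have k1 := sum_le_pairs (Xf H S) hge hc0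
    have k2 := one_le_sum (Xf H S) (by omega) hc0
    nlinarith

end Pointwise2


open Finset
open scoped Classical
set_option linter.unusedSectionVars false

section Counting
variable {n r : ℕ} {p : ℝ} {G : Finset (Finset (Fin n))}

lemma count_inter (h : Finset (Fin n)) (hh : h.card = r) (s : ℕ) (hs : s ≤ r) :
    ((Vr n r).filter (fun S => (h ∩ S).card = s)).card = r.choose s * (n - r).choose (r - s) := by
  have e1 : (Finset.powersetCard s h ×ˢ Finset.powersetCard (r - s) hᶜ).card
      = r.choose s * (n - r).choose (r - s) := by
    rw [Finset.card_product, Finset.card_powersetCard, Finset.card_powersetCard, Finset.card_compl, hh,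
      Fintype.card_fin]
  rw [← e1]
  refine Finset.card_bij' (fun S _ => (h ∩ S, S \ h)) (fun P _ => P.1 ∪ P.2) ?_ ?_ ?_ ?_
  · intro S hS
    obtain ⟨h1, h2⟩ := Finset.mem_filter.1 hS
    rw [mem_Vr] at h1
    have := Finset.card_sdiff_add_card_inter S h
    rw [Finset.inter_comm] at this
    rw [Finset.mem_product, Finset.mem_powersetCard, Finset.mem_powersetCard]
    refine ⟨⟨Finset.inter_subset_left, h2⟩, ?_, by simp only; omega⟩
    intro x hx
    rw [Finset.mem_compl]
    exact (Finset.mem_sdiff.1 hx).2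
  · rintro ⟨A, B⟩ hP
    rw [Finset.mem_product, Finset.mem_powersetCard, Finset.mem_powersetCard] at hP
    obtain ⟨⟨h1, h2⟩, h3, h4⟩ := hP
    simp only at h1 h2 h3 h4
    have hd : Disjoint h B := by
      rw [Finset.disjoint_left]; intro x hx hx2; exact (Finset.mem_compl.1 (h3 hx2)) hx
    have hAB : Disjoint A B := hd.mono_left h1
    rw [Finset.mem_filter, mem_Vr]
    refine ⟨?_, ?_⟩
    · simp only; rw [Finset.card_union_of_disjoint hAB]; omega
    · simp only
      rw [Finset.inter_union_distrib_left, Finset.inter_eq_right.2 h1,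
        Finset.disjoint_iff_inter_eq_empty.1 hd, Finset.union_empty, h2]
  · intro S _
    simp only
    rw [Finset.inter_comm, Finset.union_comm]; exact Finset.sdiff_union_inter S h
  · rintro ⟨A, B⟩ hP
    rw [Finset.mem_product, Finset.mem_powersetCard, Finset.mem_powersetCard] at hP
    obtain ⟨⟨h1, h2⟩, h3, h4⟩ := hP
    simp only at h1 h2 h3 h4
    have hd : Disjoint h B := by
      rw [Finset.disjoint_left]; intro x hx hx2; exact (Finset.mem_compl.1 (h3 hx2)) hx
    simp only [Prod.mk.injEq]
    constructor
    · rw [Finset.inter_union_distrib_left, Finset.inter_eq_right.2 h1,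
        Finset.disjoint_iff_inter_eq_empty.1 hd, Finset.union_empty]
    · rw [Finset.union_sdiff_distrib, Finset.sdiff_eq_empty_iff_subset.2 h1, Finset.empty_union,
        Finset.sdiff_eq_self_iff_disjoint.2 hd.symm]

lemma sum_adj (hr : 1 ≤ r) {h : Finset (Fin n)} (hh : h ∈ Vr n r) (F : ℕ → ℝ) :
    ∑ S ∈ Vr n r with adj h S, F (h ∩ S).card
      = ∑ s ∈ Finset.Icc 2 (r - 1), (r.choose s : ℝ) * ((n - r).choose (r - s) : ℝ) * F s := by
  rw [← Finset.sum_fiberwise_of_maps_to (t := Finset.Icc 2 (r - 1)) (g := fun S => (h ∩ S).card)]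
  · refine Finset.sum_congr rfl fun s hs => ?_
    rw [Finset.mem_Icc] at hs
    rw [Finset.sum_congr rfl (g := fun _ => F s) (fun S hS => by rw [(Finset.mem_filter.1 hS).2]),
      Finset.sum_const, nsmul_eq_mul]
    have : Finset.filter (fun S => (h ∩ S).card = s) (Finset.filter (fun S => adj h S) (Vr n r))
        = (Vr n r).filter (fun S => (h ∩ S).card = s) := by
      rw [Finset.filter_filter]
      refine Finset.filter_congr fun S _ => ⟨fun h => h.2, fun h2 => ⟨⟨?_, by omega⟩, h2⟩⟩
      rintro rfl
      rw [Finset.inter_self, mem_Vr.1 hh] at h2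
      omega
    rw [this, count_inter h (mem_Vr.1 hh) s (by omega)]
    push_cast; ring
  · intro S hS
    obtain ⟨h1, h2⟩ := Finset.mem_filter.1 hS
    rw [Finset.mem_Icc]
    exact ⟨h2.2, inter_lt (mem_Vr.1 hh) (mem_Vr.1 h1) h2.1⟩

noncomputable def lam (n r : ℕ) (p : ℝ) : ℝ := ∑ s ∈ Finset.Icc 2 (r - 1),
  (r.choose s : ℝ) * ((n - r).choose (r - s) : ℝ) * (p ^ (r.choose 2 - s.choose 2) - p ^ r.choose 2)

noncomputable def lamS (n r : ℕ) (p : ℝ) : ℝ := ∑ s ∈ Finset.Icc 2 (r - 1),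
  (r.choose s : ℝ) * ((n - r).choose (r - s) : ℝ) * p ^ (r.choose 2 - s.choose 2)

lemma lam_eq (hr : 1 ≤ r) {h : Finset (Fin n)} (hh : h ∈ Vr n r) :
    ∑ S ∈ Vr n r with adj h S, (p ^ (pr S \ pr h).card - p ^ r.choose 2) = lam n r p := by
  unfold lam
  rw [← sum_adj hr hh (fun s => p ^ (r.choose 2 - s.choose 2) - p ^ r.choose 2)]
  refine Finset.sum_congr rfl fun S hS => ?_
  rw [card_sdiff_pr (mem_Vr.1 (Finset.mem_filter.1 hS).1), Finset.inter_comm]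

lemma lamS_eq (hr : 1 ≤ r) {h : Finset (Fin n)} (hh : h ∈ Vr n r) :
    ∑ S ∈ Vr n r with adj h S, p ^ (pr S \ pr h).card = lamS n r p := by
  unfold lamS
  rw [← sum_adj hr hh (fun s => p ^ (r.choose 2 - s.choose 2))]
  refine Finset.sum_congr rfl fun S hS => ?_
  rw [card_sdiff_pr (mem_Vr.1 (Finset.mem_filter.1 hS).1), Finset.inter_comm]

lemma card_Vr : (Vr n r).card = n.choose r := by
  rw [Vr, Finset.card_powersetCard, Finset.card_univ, Fintype.card_fin]

lemma sum_g2 (hr : 1 ≤ r) : ∑ S ∈ Vr n r, ∑ T ∈ Vr n r, g2 r p S T = muR n r p * lam n r p := by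
  have : ∀ S ∈ Vr n r, ∑ T ∈ Vr n r, g2 r p S T = p ^ r.choose 2 * lam n r p := by
    intro S hS
    rw [← lam_eq hr hS, Finset.mul_sum, Finset.sum_filter]
    refine Finset.sum_congr rfl fun T _ => ?_
    unfold g2
    split_ifs
    · rw [← pow_mul_sdiff, pr_pow hS]; ring
    · rfl
  rw [Finset.sum_congr rfl this, Finset.sum_const, card_Vr, nsmul_eq_mul, muR]; ring

lemma sum_adjS (hr : 1 ≤ r) : ∑ S ∈ Vr n r, ∑ T ∈ Vr n r, (if adj S T then p ^ (pr S ∪ pr T).card else 0)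
    = muR n r p * lamS n r p := by
  have : ∀ S ∈ Vr n r, ∑ T ∈ Vr n r, (if adj S T then p ^ (pr S ∪ pr T).card else 0)
      = p ^ r.choose 2 * lamS n r p := by
    intro S hS
    rw [← lamS_eq hr hS, Finset.mul_sum, Finset.sum_filter]
    refine Finset.sum_congr rfl fun T _ => ?_
    split_ifs
    · rw [← pow_mul_sdiff, pr_pow hS]
    · rfl
  rw [Finset.sum_congr rfl this, Finset.sum_const, card_Vr, nsmul_eq_mul, muR]; ring

lemma Lam_eq (hp : 0 < p) : 2 * Lam n r p = muR n r p * lam n r p := by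
  unfold Lam muR lam
  rw [← mul_assoc, Finset.mul_sum, Finset.mul_sum]
  refine Finset.sum_congr rfl fun s hs => ?_
  rw [Finset.mem_Icc] at hs
  have : s.choose 2 ≤ r.choose 2 := Nat.choose_le_choose 2 (by omega)
  have hne : p ^ s.choose 2 ≠ 0 := by positivity
  have e : p ^ (r.choose 2 - s.choose 2) = p ^ r.choose 2 * (p ^ s.choose 2)⁻¹ := by
    rw [eq_mul_inv_iff_mul_eq₀ hne, ← pow_add, Nat.sub_add_cancel this]
  rw [e, two_mul (r.choose 2), pow_add]; ring

lemma lam_nonneg (hp : 0 ≤ p) (hp1 : p ≤ 1) : 0 ≤ lam n r p := by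
  unfold lam
  refine Finset.sum_nonneg fun s _ => mul_nonneg (by positivity) (sub_nonneg.2 ?_)
  exact pow_le_pow_of_le_one hp hp1 (Nat.sub_le _ _)

lemma lam_le (hp : 0 ≤ p) : lam n r p ≤ lamS n r p := by
  unfold lam lamS
  refine Finset.sum_le_sum fun s _ => mul_le_mul_of_nonneg_left ?_ (by positivity)
  have := pow_nonneg hp (r.choose 2)
  linarith

lemma lamS_nonneg (hp : 0 ≤ p) : 0 ≤ lamS n r p := by
  unfold lamS
  exact Finset.sum_nonneg fun s _ => by positivity

noncomputable def Err (n r : ℕ) (p : ℝ) (G : Finset (Finset (Fin n))) : ℝ :=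
  Y1 n r p G + Y2 n r p G + Y3 n r p G + p ^ (r - 1) * (Y5 n r p G + Y6 n r p G)
    + (n.choose r : ℝ) * (p ^ r.choose 2) ^ 2 + lam n r p * |((cliqueHyp n r G).card : ℝ) - muR n r p|

lemma Y2_nonneg (hp : 0 ≤ p) : 0 ≤ Y2 n r p G := by
  unfold Y2
  refine Finset.sum_nonneg fun _ _ => Finset.sum_nonneg fun _ _ => Finset.sum_nonneg fun _ _ => ?_
  split_ifs <;> positivity

lemma Y3_nonneg (hp : 0 ≤ p) : 0 ≤ Y3 n r p G := by
  unfold Y3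
  refine Finset.sum_nonneg fun _ _ => Finset.sum_nonneg fun _ _ => Finset.sum_nonneg fun _ _ => ?_
  split_ifs <;> positivity

lemma Y5_nonneg (hp : 0 ≤ p) : 0 ≤ Y5 n r p G := by
  unfold Y5
  refine Finset.sum_nonneg fun _ _ => Finset.sum_nonneg fun _ _ => ?_
  split_ifs <;> positivity

lemma Y6_nonneg (hp : 0 ≤ p) : 0 ≤ Y6 n r p G := by
  unfold Y6
  refine Finset.sum_nonneg fun _ _ => Finset.sum_nonneg fun _ _ => ?_
  split_ifs <;> positivity

lemma log_main (hr : 2 ≤ r) (hp : 0 < p) (hp1 : p ≤ 1/2) (H : Finset (Finset (Fin n)))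
    (hH : H = cliqueHyp n r G) :
    0 < qf (pairsUniv n) p (Af H) (Vr n r \ H) ∅ ∧
    |Real.log (qf (pairsUniv n) p (Af H) (Vr n r \ H) ∅)
      - (((n.choose r - H.card : ℕ) : ℝ) * Real.log (1 - p ^ r.choose 2) - Lam n r p)|
      ≤ 8 * Err n r p G := by
  have hp0 := hp.le
  have hp1' : p ≤ 1 := by linarith
  have hr1 : 1 ≤ r := by omega
  have hHV : H ⊆ Vr n r := hH ▸ cliqueHyp_sub
  obtain ⟨hpos, hJ⟩ := janson hp hp1 (Af H) (Af_sub H) (Vr n r \ H) (fun j hj => by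
    rw [Finset.mem_sdiff] at hj
    rw [hH] at hj ⊢
    exact Af_nonempty hj.1 hj.2)
  refine ⟨hpos, ?_⟩
  have hA := PA hr1 hp0 hp1' H hH
  have hB := PB hr1 hp0 hp1' H hH
  have h3 := T3J_le hp0 hp1' H hH
  have h2 := T2J_le hr1 hp0 hp1' H hH
  have h1 := T1J_le hr1 hp0 hp1' H hH
  have hcard : (Vr n r \ H).card = n.choose r - H.card := by
    rw [Finset.card_sdiff_of_subset hHV, card_Vr]
  rw [Finset.sum_const, nsmul_eq_mul, hcard,
    Finset.sum_congr rfl (fun h hh => lam_eq hr1 (hHV hh)), Finset.sum_const, nsmul_eq_mul] at hA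
  rw [sum_g2 hr1, ← Lam_eq hp] at hB
  have hL : LJ p (Af H) (Vr n r \ H) = -(∑ i ∈ Vr n r \ H, p ^ (Af H i).card) + (1/2) *
    ∑ i ∈ Vr n r \ H, ∑ j ∈ Vr n r \ H,
    if i ≠ j then p ^ (Af H i ∪ Af H j).card - p ^ (Af H i).card * p ^ (Af H j).card else 0 := rfl
  rw [hL] at hJ
  have hLam := Lam_eq (n := n) (r := r) hp
  have y1 := Y1_nonneg (n := n) (r := r) (G := G) hp0
  have y2 := Y2_nonneg (n := n) (r := r) (G := G) hp0
  have y3 := Y3_nonneg (n := n) (r := r) (G := G) hp0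
  have y5 := mul_nonneg (pow_nonneg hp0 (r - 1)) (Y5_nonneg (n := n) (r := r) (G := G) hp0)
  have y6 := mul_nonneg (pow_nonneg hp0 (r - 1)) (Y6_nonneg (n := n) (r := r) (G := G) hp0)
  have hlam := lam_nonneg (n := n) (r := r) hp0 hp1'
  have hdev : |lam n r p * ((H.card : ℝ) - muR n r p)| = lam n r p * |(H.card : ℝ) - muR n r p| := by
    rw [abs_mul, abs_of_nonneg hlam]
  have hdev0 : 0 ≤ lam n r p * |(H.card : ℝ) - muR n r p| := mul_nonneg hlam (abs_nonneg _)
  have hdev2 := abs_le.1 hdev.le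
  have hR : 1 ≤ r.choose 2 := Nat.choose_pos hr
  have hπ0 : 0 ≤ p ^ r.choose 2 := pow_nonneg hp0 _
  have hπ : p ^ r.choose 2 ≤ 1/2 := by
    calc p ^ r.choose 2 ≤ p ^ 1 := pow_le_pow_of_le_one hp0 hp1' hR
      _ ≤ 1/2 := by rwa [pow_one]
  have l1 := log_lower hπ0 hπ
  have l2 := log_upper hπ
  have hM0 : (0:ℝ) ≤ ((n.choose r - H.card : ℕ) : ℝ) := Nat.cast_nonneg _
  have hMN : ((n.choose r - H.card : ℕ) : ℝ) ≤ (n.choose r : ℝ) := by exact_mod_cast Nat.sub_le _ _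
  have hsq : 0 ≤ (n.choose r : ℝ) * (p ^ r.choose 2) ^ 2 := by positivity
  have l3 := mul_le_mul_of_nonneg_left l1 hM0
  have l4 := mul_le_mul_of_nonneg_left l2 hM0
  have l5 : ((n.choose r - H.card : ℕ) : ℝ) * (p ^ r.choose 2) ^ 2
      ≤ (n.choose r : ℝ) * (p ^ r.choose 2) ^ 2 := mul_le_mul_of_nonneg_right hMN (by positivity)
  unfold Err
  rw [← hH]
  set A := ∑ i ∈ Vr n r \ H, p ^ (Af H i).card
  set B := ∑ i ∈ Vr n r \ H, ∑ j ∈ Vr n r \ H,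
    if i ≠ j then p ^ (Af H i ∪ Af H j).card - p ^ (Af H i).card * p ^ (Af H j).card else 0
  set M := ((n.choose r - H.card : ℕ) : ℝ)
  rw [abs_le] at hA hB hJ ⊢
  constructor
  · linarith [hA.1, hA.2, hB.1, hB.2, hJ.1, hJ.2, hdev2.1, hdev2.2]
  · linarith [hA.1, hA.2, hB.1, hB.2, hJ.1, hJ.2, hdev2.1, hdev2.2]

/-- target quantity -/
noncomputable def tgt (n r : ℕ) (p : ℝ) (H : Finset (Finset (Fin n))) : ℝ :=
  (p ^ r.choose 2) ^ H.card * (1 - p ^ r.choose 2) ^ (n.choose r - H.card) *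
                p ^ (-(tHyp n r H)) * Real.exp (-(Lam n r p))

lemma pointwise (hr : 2 ≤ r) (hp : 0 < p) (hp1 : p ≤ 1/2) (H : Finset (Finset (Fin n)))
    (hH : H = cliqueHyp n r G) (δ : ℝ) (hδ : 8 * Err n r p G ≤ δ) :
    Real.exp (-δ) * tgt n r p H ≤ gnpProb n p {G | cliqueHyp n r G = H} ∧
    gnpProb n p {G | cliqueHyp n r G = H} ≤ Real.exp δ * tgt n r p H := by
  obtain ⟨hpos, hlog⟩ := log_main hr hp hp1 H hH
  have hHV : H ⊆ Vr n r := hH ▸ cliqueHyp_sub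
  rw [prob_eq hHV]
  have hR : 1 ≤ r.choose 2 := Nat.choose_pos hr
  have hπ : p ^ r.choose 2 ≤ 1/2 := by
    calc p ^ r.choose 2 ≤ p ^ 1 := pow_le_pow_of_le_one hp.le (by linarith) hR
      _ ≤ 1/2 := by rwa [pow_one]
  have h1 : 0 < 1 - p ^ r.choose 2 := by linarith
  have htgt : tgt n r p H = p ^ (hypGraph n H).card * Real.exp
      (((n.choose r - H.card : ℕ) : ℝ) * Real.log (1 - p ^ r.choose 2) - Lam n r p) := by
    have e1 : (p ^ r.choose 2) ^ H.card * p ^ (-(tHyp n r H)) = p ^ (hypGraph n H).card := by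
      rw [← pow_mul, ← zpow_natCast, ← zpow_add₀ hp.ne', ← zpow_natCast]
      congr 1
      unfold tHyp; push_cast; ring
    have e2 : Real.exp (((n.choose r - H.card : ℕ) : ℝ) * Real.log (1 - p ^ r.choose 2))
        = (1 - p ^ r.choose 2) ^ (n.choose r - H.card) := by
      rw [mul_comm, Real.exp_mul, Real.exp_log h1, Real.rpow_natCast]
    rw [← e1, sub_eq_add_neg, Real.exp_add, e2, tgt]; ring
  rw [htgt]
  set q := qf (pairsUniv n) p (Af H) (Vr n r \ H) ∅
  set L := (((n.choose r - H.card : ℕ) : ℝ) * Real.log (1 - p ^ r.choose 2) - Lam n r p)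
  have hq : q = Real.exp (Real.log q) := (Real.exp_log hpos).symm
  have hc : 0 ≤ p ^ (hypGraph n H).card := pow_nonneg hp.le _
  rw [abs_le] at hlog
  rw [mul_left_comm, mul_left_comm (Real.exp δ), ← Real.exp_add, ← Real.exp_add, hq]
  constructor
  · refine mul_le_mul_of_nonneg_left (Real.exp_le_exp.2 ?_) hc
    linarith [hlog.1]
  · refine mul_le_mul_of_nonneg_left (Real.exp_le_exp.2 ?_) hc
    linarith [hlog.2]

end Counting


open Finset
open scoped Classical
set_option linter.unusedSectionVars false

section Expect
variable {n r : ℕ} {p : ℝ}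

noncomputable def T3s (n r : ℕ) (p : ℝ) : ℝ :=
  ∑ S ∈ Vr n r, ∑ T ∈ Vr n r, ∑ U ∈ Vr n r,
    if ch S T U then p ^ (pr S ∪ pr T ∪ pr U).card else 0

lemma two_pow_le (hp : 0 ≤ p) {k m : ℕ} (h : k ≤ m) : (2 * p) ^ k ≤ 2 ^ m * p ^ k := by
  rw [mul_pow]
  exact mul_le_mul_of_nonneg_right (pow_le_pow_right₀ (by norm_num) h) (pow_nonneg hp _)

lemma mixed_le (hp : 0 ≤ p) (hp1 : p ≤ 1) {A B W : Finset (Finset (Fin n))} (hW : A ∪ B = W)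
    (hWE : W ⊆ pairsUniv n) {m : ℕ} (hm : W.card ≤ m) :
    ex (pairsUniv n) p (fun G => if B ⊆ G then p ^ (A \ G).card else 0) ≤ 2 ^ m * p ^ W.card := by
  subst hW
  have := ex_mixed (Finset.union_subset_left hWE) (Finset.union_subset_right hWE) hp hp1
  exact this.trans (two_pow_le hp hm)

lemma ex_if {c : Prop} {f : Finset (Finset (Fin n)) → ℝ} {b : ℝ}
    (h : c → ex (pairsUniv n) p f ≤ b) :
    ex (pairsUniv n) p (fun G => if c then f G else 0) ≤ if c then b else 0 := by
  by_cases hc : c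
  · simp only [hc, if_true]; exact h hc
  · simp only [hc, if_false]; rw [ex_const]

lemma card3 {S T U : Finset (Fin n)} (hS : S ∈ Vr n r) (hT : T ∈ Vr n r) (hU : U ∈ Vr n r) :
    (pr S ∪ pr T ∪ pr U).card ≤ 3 * r.choose 2 := by
  have h1 := Finset.card_union_le (pr S ∪ pr T) (pr U)
  have h2 := Finset.card_union_le (pr S) (pr T)
  rw [card_pr, mem_Vr.1 hS, card_pr, mem_Vr.1 hT] at h2
  rw [card_pr U, mem_Vr.1 hU] at h1
  omega

lemma card2 {S T : Finset (Fin n)} (hS : S ∈ Vr n r) (hT : T ∈ Vr n r) :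
    (pr S ∪ pr T).card ≤ 3 * r.choose 2 := by
  have h2 := Finset.card_union_le (pr S) (pr T)
  rw [card_pr, mem_Vr.1 hS, card_pr, mem_Vr.1 hT] at h2
  omega

lemma sum3 {f : Finset (Fin n) → Finset (Fin n) → Finset (Fin n) → Finset (Finset (Fin n)) → ℝ}
    {c : ℝ} {g : Finset (Fin n) → Finset (Fin n) → Finset (Fin n) → ℝ}
    (h : ∀ S ∈ Vr n r, ∀ T ∈ Vr n r, ∀ U ∈ Vr n r, ch S T U → ex (pairsUniv n) p (f S T U) ≤ c * g S T U) :
    ex (pairsUniv n) p (fun G => ∑ S ∈ Vr n r, ∑ T ∈ Vr n r, ∑ U ∈ Vr n r,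
      if ch S T U then f S T U G else 0)
      ≤ c * ∑ S ∈ Vr n r, ∑ T ∈ Vr n r, ∑ U ∈ Vr n r, if ch S T U then g S T U else 0 := by
  simp only [ex_sum, Finset.mul_sum]
  refine Finset.sum_le_sum fun S hS => Finset.sum_le_sum fun T hT => Finset.sum_le_sum fun U hU => ?_
  refine (ex_if (h S hS T hT U hU)).trans (le_of_eq ?_)
  split_ifs <;> simp

lemma sum2 {f : Finset (Fin n) → Finset (Fin n) → Finset (Finset (Fin n)) → ℝ}
    {c : ℝ} {g : Finset (Fin n) → Finset (Fin n) → ℝ}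
    (h : ∀ S ∈ Vr n r, ∀ T ∈ Vr n r, adj S T → ex (pairsUniv n) p (f S T) ≤ c * g S T) :
    ex (pairsUniv n) p (fun G => ∑ S ∈ Vr n r, ∑ T ∈ Vr n r, if adj S T then f S T G else 0)
      ≤ c * ∑ S ∈ Vr n r, ∑ T ∈ Vr n r, if adj S T then g S T else 0 := by
  simp only [ex_sum, Finset.mul_sum]
  refine Finset.sum_le_sum fun S hS => Finset.sum_le_sum fun T hT => ?_
  refine (ex_if (h S hS T hT)).trans (le_of_eq ?_)
  split_ifs <;> simp

lemma pr3_sub (S T U : Finset (Fin n)) : pr S ∪ pr T ∪ pr U ⊆ pairsUniv n :=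
  Finset.union_subset (Finset.union_subset (pr_sub S) (pr_sub T)) (pr_sub U)

lemma EY1 (hp : 0 ≤ p) (hp1 : p ≤ 1) :
    ex (pairsUniv n) p (Y1 n r p) ≤ 2 ^ (3 * r.choose 2) * T3s n r p := by
  refine sum3 (f := fun S T U G => if pr S ∪ pr U ⊆ G then p ^ (pr T \ G).card else 0)
    (g := fun S T U => p ^ (pr S ∪ pr T ∪ pr U).card) fun S hS T hT U hU _ => ?_
  exact mixed_le hp hp1 (by ext; simp only [Finset.mem_union]; tauto) (pr3_sub S T U) (card3 hS hT hU)

lemma EY2 (hp : 0 ≤ p) (hp1 : p ≤ 1) :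
    ex (pairsUniv n) p (Y2 n r p) ≤ 2 ^ (3 * r.choose 2) * T3s n r p := by
  refine sum3 (f := fun S T U G => if pr S ⊆ G then p ^ ((pr T ∪ pr U) \ G).card else 0)
    (g := fun S T U => p ^ (pr S ∪ pr T ∪ pr U).card) fun S hS T hT U hU _ => ?_
  exact mixed_le hp hp1 (by ext; simp only [Finset.mem_union]; tauto) (pr3_sub S T U) (card3 hS hT hU)

lemma EY3 (hp : 0 ≤ p) (hp1 : p ≤ 1) :
    ex (pairsUniv n) p (Y3 n r p) ≤ 2 ^ (3 * r.choose 2) * T3s n r p := by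
  refine sum3 (f := fun S T U G => p ^ ((pr S ∪ pr T ∪ pr U) \ G).card)
    (g := fun S T U => p ^ (pr S ∪ pr T ∪ pr U).card) fun S hS T hT U hU _ => ?_
  have := mixed_le (B := ∅) hp hp1 (Finset.union_empty _) (pr3_sub S T U) (card3 hS hT hU)
  simpa using this

lemma EY5 (hr : 1 ≤ r) (hp : 0 ≤ p) (hp1 : p ≤ 1) :
    ex (pairsUniv n) p (Y5 n r p) ≤ 2 ^ (3 * r.choose 2) * (muR n r p * lamS n r p) := by
  rw [← sum_adjS hr]
  refine sum2 (f := fun S T G => if pr S ⊆ G then p ^ (pr T \ G).card else 0)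
    (g := fun S T => p ^ (pr S ∪ pr T).card) fun S hS T hT _ => ?_
  exact mixed_le hp hp1 (Finset.union_comm _ _) (Finset.union_subset (pr_sub S) (pr_sub T)) (card2 hS hT)

lemma EY6 (hr : 1 ≤ r) (hp : 0 ≤ p) (hp1 : p ≤ 1) :
    ex (pairsUniv n) p (Y6 n r p) ≤ 2 ^ (3 * r.choose 2) * (muR n r p * lamS n r p) := by
  rw [← sum_adjS hr]
  refine sum2 (f := fun S T G => p ^ ((pr S ∪ pr T) \ G).card)
    (g := fun S T => p ^ (pr S ∪ pr T).card) fun S hS T hT _ => ?_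
  have := mixed_le (B := ∅) hp hp1 (Finset.union_empty _)
    (Finset.union_subset (pr_sub S) (pr_sub T)) (card2 hS hT)
  simpa using this

lemma card_cliqueHyp (G : Finset (Finset (Fin n))) :
    ((cliqueHyp n r G).card : ℝ) = ∑ S ∈ Vr n r, if pr S ⊆ G then (1:ℝ) else 0 := by
  rw [← Finset.sum_filter, Finset.sum_const, nsmul_eq_mul, mul_one]; rfl

lemma Evar (hr : 1 ≤ r) (hp : 0 ≤ p) :
    ex (pairsUniv n) p (fun G => (((cliqueHyp n r G).card : ℝ) - muR n r p) ^ 2)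
      ≤ muR n r p * (1 + lamS n r p) := by
  have hmu : muR n r p = ∑ _S ∈ Vr n r, p ^ r.choose 2 := by
    rw [Finset.sum_const, nsmul_eq_mul, card_Vr, muR]
  have h1 : ∀ G : Finset (Finset (Fin n)), (((cliqueHyp n r G).card : ℝ) - muR n r p) ^ 2
      = ∑ S ∈ Vr n r, ∑ T ∈ Vr n r, (((if pr S ∪ pr T ⊆ G then (1:ℝ) else 0)
        - p ^ r.choose 2 * (if pr S ⊆ G then (1:ℝ) else 0))
        - p ^ r.choose 2 * (if pr T ⊆ G then (1:ℝ) else 0) + p ^ r.choose 2 * p ^ r.choose 2) := by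
    intro G
    rw [card_cliqueHyp, hmu, ← Finset.sum_sub_distrib, sq, Finset.sum_mul_sum]
    refine Finset.sum_congr rfl fun S _ => Finset.sum_congr rfl fun T _ => ?_
    by_cases a : pr S ⊆ G <;> by_cases b : pr T ⊆ G <;> simp [a, b, Finset.union_subset_iff] <;> ring
  simp only [h1, ex_sum, ex_add, ex_sub, ex_mul, ex_const]
  have h2 : muR n r p * (1 + lamS n r p) = ∑ S ∈ Vr n r, ∑ T ∈ Vr n r,
      ((if S = T then p ^ r.choose 2 else 0) + (if adj S T then p ^ (pr S ∪ pr T).card else 0)) := by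
    simp only [Finset.sum_add_distrib]
    rw [sum_adjS hr, mul_add, mul_one]
    congr 1
    rw [hmu]
    refine Finset.sum_congr rfl fun S hS => ?_
    rw [Finset.sum_ite_eq, if_pos hS]
  rw [h2]
  refine Finset.sum_le_sum fun S hS => Finset.sum_le_sum fun T hT => ?_
  rw [ex_subset (Finset.union_subset (pr_sub S) (pr_sub T)), ex_subset (pr_sub S), ex_subset (pr_sub T),
    pr_pow hS, pr_pow hT]
  have hpp : 0 ≤ p ^ r.choose 2 * p ^ r.choose 2 := by positivity
  by_cases hST : S = T
  · subst hST
    rw [Finset.union_self, pr_pow hS, if_pos rfl]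
    have : 0 ≤ (if adj S S then p ^ r.choose 2 else 0) := by split_ifs <;> positivity
    linarith
  · rw [if_neg hST]
    by_cases ha : adj S T
    · rw [if_pos ha]; linarith
    · rw [if_neg ha, Finset.card_union_of_disjoint (disj_of_not_adj hST ha), pow_add, pr_pow hS, pr_pow hT]
      linarith

lemma T3s_nonneg (hp : 0 ≤ p) : 0 ≤ T3s n r p := by
  unfold T3s
  refine Finset.sum_nonneg fun _ _ => Finset.sum_nonneg fun _ _ => Finset.sum_nonneg fun _ _ => ?_
  split_ifs <;> positivity

lemma Err_nonneg (hp : 0 ≤ p) (hp1 : p ≤ 1) (G : Finset (Finset (Fin n))) : 0 ≤ Err n r p G := by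
  unfold Err
  have y1 := Y1_nonneg (n := n) (r := r) (G := G) hp
  have y2 := Y2_nonneg (n := n) (r := r) (G := G) hp
  have y3 := Y3_nonneg (n := n) (r := r) (G := G) hp
  have y5 := Y5_nonneg (n := n) (r := r) (G := G) hp
  have y6 := Y6_nonneg (n := n) (r := r) (G := G) hp
  have hlam := lam_nonneg (n := n) (r := r) hp hp1
  have e1 := mul_nonneg (pow_nonneg hp (r - 1)) (add_nonneg y5 y6)
  have e2 : 0 ≤ (n.choose r : ℝ) * (p ^ r.choose 2) ^ 2 :=
    mul_nonneg (Nat.cast_nonneg _) (sq_nonneg _)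
  have e3 := mul_nonneg hlam (abs_nonneg (((cliqueHyp n r G).card : ℝ) - muR n r p))
  linarith

lemma EErr (hr : 1 ≤ r) (hp : 0 ≤ p) (hp1 : p ≤ 1) {a : ℝ} (ha : 0 < a) :
    ex (pairsUniv n) p (Err n r p) ≤ 2 ^ (3 * r.choose 2) * (3 * T3s n r p
      + 2 * p ^ (r - 1) * (muR n r p * lamS n r p)) + (n.choose r : ℝ) * (p ^ r.choose 2) ^ 2
      + lamS n r p * (a + muR n r p * (1 + lamS n r p) / a) := by
  have hlam := lam_nonneg (n := n) (r := r) hp hp1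
  have h1 : ex (pairsUniv n) p (Err n r p) ≤ ex (pairsUniv n) p (fun G =>
      Y1 n r p G + Y2 n r p G + Y3 n r p G + p ^ (r - 1) * (Y5 n r p G + Y6 n r p G)
      + (n.choose r : ℝ) * (p ^ r.choose 2) ^ 2
      + lam n r p * (a + a⁻¹ * (((cliqueHyp n r G).card : ℝ) - muR n r p) ^ 2)) := by
    refine ex_mono hp hp1 fun G _ => ?_
    unfold Err
    refine add_le_add le_rfl (mul_le_mul_of_nonneg_left ?_ hlam)
    set x := ((cliqueHyp n r G).card : ℝ) - muR n r p
    rw [← sq_abs x]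
    have hx := abs_nonneg x
    have : a + a⁻¹ * |x| ^ 2 = (a ^ 2 + |x| ^ 2) / a := by field_simp
    rw [this, le_div_iff₀ ha]
    nlinarith [sq_nonneg (a - |x|)]
  refine h1.trans ?_
  simp only [ex_add, ex_mul, ex_const]
  have e1 := EY1 (n := n) (r := r) hp hp1
  have e2 := EY2 (n := n) (r := r) hp hp1
  have e3 := EY3 (n := n) (r := r) hp hp1
  have e5 := EY5 (n := n) hr hp hp1
  have e6 := EY6 (n := n) hr hp hp1
  have ev := Evar (n := n) hr hp
  have hl := lam_le (n := n) (r := r) hp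
  have e56 := mul_le_mul_of_nonneg_left (add_le_add e5 e6) (pow_nonneg hp (r - 1))
  have ev2 := mul_le_mul_of_nonneg_left ev (inv_nonneg.2 ha.le)
  have hE0 : 0 ≤ ex (pairsUniv n) p (fun G => (((cliqueHyp n r G).card : ℝ) - muR n r p) ^ 2) :=
    ex_nonneg hp hp1 fun G _ => sq_nonneg _
  have ev3 := mul_le_mul hl (add_le_add (le_refl a) ev2) (by positivity) (lamS_nonneg hp)
  rw [div_eq_inv_mul]
  have w1 : ex (pairsUniv n) p (fun G => Y1 n r p G) = ex (pairsUniv n) p (Y1 n r p) := rfl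
  have w2 : ex (pairsUniv n) p (fun G => Y2 n r p G) = ex (pairsUniv n) p (Y2 n r p) := rfl
  have w3 : ex (pairsUniv n) p (fun G => Y3 n r p G) = ex (pairsUniv n) p (Y3 n r p) := rfl
  have w5 : ex (pairsUniv n) p (fun G => Y5 n r p G) = ex (pairsUniv n) p (Y5 n r p) := rfl
  have w6 : ex (pairsUniv n) p (fun G => Y6 n r p G) = ex (pairsUniv n) p (Y6 n r p) := rfl
  rw [w1, w2, w3, w5, w6]
  generalize ex (pairsUniv n) p (Y1 n r p) = z1 at *
  generalize ex (pairsUniv n) p (Y2 n r p) = z2 at *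
  generalize ex (pairsUniv n) p (Y3 n r p) = z3 at *
  generalize ex (pairsUniv n) p (Y5 n r p) = z5 at *
  generalize ex (pairsUniv n) p (Y6 n r p) = z6 at *
  generalize ex (pairsUniv n) p (fun G => (((cliqueHyp n r G).card : ℝ) - muR n r p) ^ 2) = zz at *
  generalize (2:ℝ) ^ (3 * r.choose 2) = c at *
  linarith

end Expect


open Finset
open scoped Classical
set_option linter.unusedSectionVars false

section Triples
variable {n r : ℕ} {p : ℝ}

lemma arith {r s a b c : ℤ} (hr : 5 ≤ r) (hs2 : 2 ≤ s) (hsr : s ≤ r - 1) (ha0 : 0 ≤ a) (hb0 : 0 ≤ b)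
    (hcs : c ≤ s) (ha : a ≤ r - s) (hb : b ≤ r - s) (hbc2 : 2 ≤ b + c)
    (hbc : b + c ≤ r - 1) (hac : a + c ≤ r - 1) (hy : a + b + c ≤ r) :
    3 * r + 1 ≤ s * (r + 1 - s) + (a + b + c) * (r + 1 - (a + b + c)) + 2 * (a * b)
    ∨ (s = r - 1 ∧ a = 1 ∧ b = 1 ∧ c = r - 2) := by
  have hs : 2 * (r - 1) ≤ s * (r + 1 - s) := by nlinarith
  have hab : 0 ≤ a * b := mul_nonneg ha0 hb0
  rcases lt_or_eq_of_le hy with hlt | heq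
  · left
    have : 2 * (r - 1) ≤ (a + b + c) * (r + 1 - (a + b + c)) := by nlinarith
    linarith
  · have ha1 : 1 ≤ a := by linarith
    have hb1 : 1 ≤ b := by linarith
    rw [heq]
    rcases lt_or_eq_of_le hsr with hlt | hseq
    · left
      rcases lt_or_eq_of_le hs2 with h3 | h2
      · have : 3 * (r - 2) ≤ s * (r + 1 - s) := by nlinarith
        have : 1 ≤ a * b := by nlinarith
        linarith
      · subst h2
        have : 2 ≤ a * b := by nlinarith
        linarith
    · right
      refine ⟨hseq, ?_, ?_, ?_⟩ <;> linarith

lemma two_choose (k : ℕ) : (2 * (k.choose 2 : ℕ) : ℤ) = (k : ℤ) * (k - 1) := by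
  induction k with
  | zero => simp
  | succ k ih =>
    rw [Nat.choose_succ_succ' k 1, Nat.choose_one_right]
    push_cast at ih ⊢
    linarith

lemma triple (hr : 5 ≤ r) {S T U : Finset (Fin n)} (hS : S ∈ Vr n r) (hT : T ∈ Vr n r) (hU : U ∈ Vr n r)
    (h : ch S T U) : r * (S ∪ T ∪ U).card + 1 ≤ 2 * (pr S ∪ pr T ∪ pr U).card ∨
      ((S ∪ T ∪ U).card = r + 1 ∧ (pr S ∪ pr T ∪ pr U).card = (r + 1).choose 2) := by
  obtain ⟨hST, hUT, hSU⟩ := h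
  rw [mem_Vr] at hS hT hU
  have s2 := hST.2
  have s1 := inter_lt hS hT hST.1
  have u2 := hUT.2
  have u1 := inter_lt hU hT hUT.1
  have w1 := inter_lt hU hS hSU.symm
  -- vertex sets
  have e1 := Finset.card_union_add_card_inter S T
  have e2 := Finset.card_union_add_card_inter (S ∪ T) U
  have e3 : ((S ∪ T) ∩ U).card + (S ∩ T ∩ U).card = (U ∩ S).card + (U ∩ T).card := by
    have := Finset.card_union_add_card_inter (U ∩ S) (U ∩ T)
    rw [← Finset.inter_union_distrib_left, ← Finset.inter_inter_distrib_left] at this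
    rwa [Finset.inter_comm (S ∪ T) U, Finset.inter_comm (S ∩ T) U]
  -- edge sets
  have f1 := Finset.card_union_add_card_inter (pr S) (pr T)
  have f2 := Finset.card_union_add_card_inter (pr S ∪ pr T) (pr U)
  have f3 : ((pr S ∪ pr T) ∩ pr U).card + (pr (S ∩ T ∩ U)).card = (pr (U ∩ S)).card + (pr (U ∩ T)).card := by
    have := Finset.card_union_add_card_inter (pr U ∩ pr S) (pr U ∩ pr T)
    rw [← Finset.inter_union_distrib_left, ← Finset.inter_inter_distrib_left] at this
    rw [Finset.inter_comm (S ∩ T) U, ← pr_inter, ← pr_inter, ← pr_inter, ← pr_inter,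
      Finset.inter_comm (pr S ∪ pr T)]
    exact this
  rw [pr_inter, card_pr, card_pr, card_pr, hS, hT] at f1
  rw [card_pr U, hU] at f2
  rw [card_pr, card_pr, card_pr] at f3
  rw [hS, hT] at e1
  rw [hU] at e2
  -- containments
  have k1 : (S ∩ T ∩ U).card ≤ (S ∩ T).card := Finset.card_le_card Finset.inter_subset_left
  have k2 : (S ∩ T ∩ U).card ≤ (U ∩ S).card := Finset.card_le_card (by
    intro x; simp only [Finset.mem_inter]; tauto)
  have k3 : (S ∩ T ∩ U).card ≤ (U ∩ T).card := Finset.card_le_card (by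
    intro x; simp only [Finset.mem_inter]; tauto)
  have k4 : (U ∩ S).card + (S ∩ T).card ≤ r + (S ∩ T ∩ U).card := by
    have := Finset.card_union_add_card_inter (U ∩ S) (S ∩ T)
    have h1 : ((U ∩ S) ∪ (S ∩ T)).card ≤ S.card := Finset.card_le_card (by
      intro x; simp only [Finset.mem_union, Finset.mem_inter]; tauto)
    have h2 : (U ∩ S) ∩ (S ∩ T) = S ∩ T ∩ U := by
      ext x; simp only [Finset.mem_inter]; tauto
    rw [h2] at this
    omega
  have k5 : (U ∩ T).card + (S ∩ T).card ≤ r + (S ∩ T ∩ U).card := by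
    have := Finset.card_union_add_card_inter (U ∩ T) (S ∩ T)
    have h1 : ((U ∩ T) ∪ (S ∩ T)).card ≤ T.card := Finset.card_le_card (by
      intro x; simp only [Finset.mem_union, Finset.mem_inter]; tauto)
    have h2 : (U ∩ T) ∩ (S ∩ T) = S ∩ T ∩ U := by
      ext x; simp only [Finset.mem_inter]; tauto
    rw [h2] at this
    omega
  have k6 : ((S ∪ T) ∩ U).card ≤ r := hU ▸ Finset.card_le_card Finset.inter_subset_right
  generalize (S ∪ T ∪ U).card = v at *
  generalize (pr S ∪ pr T ∪ pr U).card = e at *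
  generalize (S ∩ T ∩ U).card = c at *
  generalize (S ∩ T).card = s at *
  generalize (pr S ∪ pr T).card = e' at *
  generalize ((pr S ∪ pr T) ∩ pr U).card = e'' at *
  generalize ((S ∪ T) ∩ U).card = y at *
  generalize (S ∪ T).card = v' at *
  generalize (U ∩ S).card = us at *
  generalize (U ∩ T).card = ut at *
  obtain ⟨a, rfl⟩ : ∃ a, us = a + c := ⟨us - c, by omega⟩
  obtain ⟨b, rfl⟩ : ∃ b, ut = b + c := ⟨ut - c, by omega⟩
  have hyy : y = a + b + c := by omega
  subst hyy
  have q1 := two_choose r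
  have q2 := two_choose s
  have q3 := two_choose (a + c)
  have q4 := two_choose (b + c)
  have q5 := two_choose c
  have q6 := two_choose (r + 1)
  zify at f1 f2 f3 e1 e2
  push_cast at q1 q2 q3 q4 q5 q6
  have hv : (v : ℤ) = 3 * r - s - (a + b + c) := by linarith
  have he : 2 * (e : ℤ) = 3 * (r * (r - 1)) - s * (s - 1) - ((a + c) * (a + c - 1) + (b + c) * (b + c - 1)
    - c * (c - 1)) := by linarith
  have key := arith (r := r) (s := s) (a := a) (b := b) (c := c) (by exact_mod_cast hr) (by omega)
    (by omega) (by omega) (by omega) (by omega) (by omega) (by omega) (by omega)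
    (by omega) (by omega) (by omega)
  rcases key with hk | ⟨h1, h2, h3, h4⟩
  · left
    zify
    rw [he, hv]
    nlinarith
  · right
    have : (v : ℤ) = r + 1 := by rw [hv, h1, h2, h3, h4]; ring
    refine ⟨by exact_mod_cast this, ?_⟩
    have : (e : ℤ) = ((r + 1).choose 2 : ℕ) := by
      have : 2 * (e : ℤ) = 2 * ((r + 1).choose 2 : ℕ) := by
        rw [he, q6, h1, h2, h3, h4]; ring
      linarith
    exact_mod_cast this

/-- ordered triples with union of given size -/
lemma count_triples (Q : Finset (Finset (Fin n) × Finset (Fin n) × Finset (Fin n))) (v : ℕ)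
    (hQ : ∀ q ∈ Q, (q.1 ∪ q.2.1 ∪ q.2.2).card = v) : Q.card ≤ n.choose v * 8 ^ v := by
  have hsub : Q ⊆ (Vr n v).biUnion (fun W => W.powerset ×ˢ W.powerset ×ˢ W.powerset) := by
    intro q hq
    rw [Finset.mem_biUnion]
    refine ⟨q.1 ∪ q.2.1 ∪ q.2.2, mem_Vr.2 (hQ q hq), ?_⟩
    simp only [Finset.mem_product, Finset.mem_powerset]
    refine ⟨?_, ?_, ?_⟩
    · exact Finset.subset_union_left.trans Finset.subset_union_left
    · exact Finset.subset_union_right.trans Finset.subset_union_left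
    · exact Finset.subset_union_right
  refine (Finset.card_le_card hsub).trans ?_
  refine (Finset.card_biUnion_le_card_mul _ _ (8 ^ v) fun W hW => ?_).trans ?_
  · rw [Finset.card_product, Finset.card_product, Finset.card_powerset, mem_Vr.1 hW, ← mul_pow, ← mul_pow]
    norm_num
  · rw [card_Vr]

lemma T3s_le (hr : 5 ≤ r) (hn : 1 ≤ n) (hp : 0 ≤ p) {θ : ℝ} (hθ : 0 ≤ θ)
    (H : ∀ v e : ℕ, r * v + 1 ≤ 2 * e → e ≤ 3 * r.choose 2 → p ^ e ≤ θ * ((n : ℝ) ^ v)⁻¹) :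
    T3s n r p ≤ 8 ^ (3 * r) * (((n.choose (r + 1) : ℝ) * p ^ (r + 1).choose 2) + (3 * r + 1) * θ) := by
  set Q := (Vr n r ×ˢ Vr n r ×ˢ Vr n r).filter (fun q => ch q.1 q.2.1 q.2.2) with hQ
  have h1 : T3s n r p = ∑ q ∈ Q, p ^ (pr q.1 ∪ pr q.2.1 ∪ pr q.2.2).card := by
    rw [hQ, Finset.sum_filter, T3s, Finset.sum_product]
    refine Finset.sum_congr rfl fun S _ => ?_
    rw [Finset.sum_product]
  set f : ℕ → ℝ := fun v => (if v = r + 1 then p ^ (r + 1).choose 2 else 0) + θ * ((n : ℝ) ^ v)⁻¹ with hf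
  have hn0 : (0:ℝ) < n := by exact_mod_cast hn
  have hf0 : ∀ v, 0 ≤ f v := by
    intro v
    simp only [hf]
    split_ifs <;> positivity
  have h2 : ∀ q ∈ Q, p ^ (pr q.1 ∪ pr q.2.1 ∪ pr q.2.2).card ≤ f (q.1 ∪ q.2.1 ∪ q.2.2).card := by
    rintro ⟨S, T, U⟩ hq
    simp only [hQ, Finset.mem_filter, Finset.mem_product] at hq
    obtain ⟨⟨hS, hT, hU⟩, hc⟩ := hq
    simp only
    rcases triple hr hS hT hU hc with h | ⟨h, h'⟩
    · refine (H _ _ h (card3 hS hT hU)).trans ?_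
      simp only [hf]
      refine le_add_of_nonneg_left ?_
      split_ifs <;> positivity
    · rw [h, h']
      simp only [hf, if_true]
      refine le_add_of_nonneg_right ?_
      positivity
  have h3 : ∀ q ∈ Q, (q.1 ∪ q.2.1 ∪ q.2.2).card ∈ Finset.range (3 * r + 1) := by
    rintro ⟨S, T, U⟩ hq
    simp only [hQ, Finset.mem_filter, Finset.mem_product, mem_Vr] at hq
    obtain ⟨⟨hS, hT, hU⟩, hc⟩ := hq
    have a1 := Finset.card_union_le (S ∪ T) U
    have a2 := Finset.card_union_le S T
    rw [Finset.mem_range]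
    simp only
    omega
  rw [h1]
  refine (Finset.sum_le_sum h2).trans ?_
  rw [← Finset.sum_fiberwise_of_maps_to h3]
  have h4 : ∀ v ∈ Finset.range (3 * r + 1),
      ∑ q ∈ Q with (q.1 ∪ q.2.1 ∪ q.2.2).card = v, f (q.1 ∪ q.2.1 ∪ q.2.2).card
        ≤ 8 ^ (3 * r) * ((if v = r + 1 then (n.choose (r + 1) : ℝ) * p ^ (r + 1).choose 2 else 0) + θ) := by
    intro v hv
    rw [Finset.mem_range] at hv
    rw [Finset.sum_congr rfl (g := fun _ => f v) (fun q hq => by rw [(Finset.mem_filter.1 hq).2]),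
      Finset.sum_const, nsmul_eq_mul]
    have c1 := count_triples (Q.filter (fun q => (q.1 ∪ q.2.1 ∪ q.2.2).card = v)) v
      (fun q hq => (Finset.mem_filter.1 hq).2)
    have c2 : ((Q.filter (fun q => (q.1 ∪ q.2.1 ∪ q.2.2).card = v)).card : ℝ)
        ≤ (n.choose v : ℝ) * 8 ^ v := by exact_mod_cast c1
    have c3 : (8:ℝ) ^ v ≤ 8 ^ (3 * r) := pow_le_pow_right₀ (by norm_num) (by omega)
    have c4 : (n.choose v : ℝ) ≤ (n : ℝ) ^ v := by exact_mod_cast Nat.choose_le_pow n v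
    calc _ ≤ (n.choose v : ℝ) * 8 ^ v * f v := mul_le_mul_of_nonneg_right c2 (hf0 v)
      _ ≤ (n.choose v : ℝ) * 8 ^ (3 * r) * f v := by
          refine mul_le_mul_of_nonneg_right (mul_le_mul_of_nonneg_left c3 (Nat.cast_nonneg _)) (hf0 v)
      _ = 8 ^ (3 * r) * ((n.choose v : ℝ) * f v) := by ring
      _ ≤ _ := by
          refine mul_le_mul_of_nonneg_left ?_ (by positivity)
          simp only [hf]
          rw [mul_add]
          refine add_le_add ?_ ?_
          · split_ifs with h
            · rw [h]
            · simp
          · calc (n.choose v : ℝ) * (θ * ((n : ℝ) ^ v)⁻¹) ≤ (n : ℝ) ^ v * (θ * ((n : ℝ) ^ v)⁻¹) :=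
                mul_le_mul_of_nonneg_right c4 (by positivity)
              _ = θ := by
                have : (n : ℝ) ^ v ≠ 0 := by positivity
                field_simp
  refine (Finset.sum_le_sum h4).trans ?_
  rw [← Finset.mul_sum, Finset.sum_add_distrib, Finset.sum_ite_eq', Finset.sum_const, Finset.card_range,
    nsmul_eq_mul, if_pos (by rw [Finset.mem_range]; omega)]
  push_cast
  exact le_rfl

end Triples


open Finset
open scoped Classical
set_option linter.unusedSectionVars false

section Bounds
variable {n r : ℕ} {p : ℝ}

noncomputable def gam (r : ℕ) : ℝ := 1 / (8 * (r : ℝ) ^ 3)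

lemma choose_two_real (k : ℕ) : (2 * (k.choose 2 : ℕ) : ℝ) = (k : ℝ) * (k - 1) := by
  have := two_choose k
  exact_mod_cast this

lemma gam_facts (hr : 5 ≤ r) : 0 < gam r ∧ (1 / (r:ℝ)) ≤ 1/5 ∧ 0 < 1 / (r:ℝ) ∧
    gam r * (r.choose 2 : ℝ) ≤ (1 / (r:ℝ)) / 16 ∧ 0 ≤ gam r * (r.choose 2 : ℝ) ∧
    2 * gam r ≤ (1 / (r:ℝ)) / 100 := by
  have hr5 : (5:ℝ) ≤ r := by exact_mod_cast hr
  have hr0 : (0:ℝ) < r := by linarith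
  have hg : 0 < gam r := by unfold gam; positivity
  have hR := choose_two_real r
  refine ⟨hg, ?_, by positivity, ?_, by positivity, ?_⟩
  · exact one_div_le_one_div_of_le (by norm_num) hr5
  · have : (r.choose 2 : ℝ) ≤ (r:ℝ) ^ 2 / 2 := by nlinarith
    calc gam r * (r.choose 2 : ℝ) ≤ gam r * ((r:ℝ) ^ 2 / 2) := mul_le_mul_of_nonneg_left this hg.le
      _ = (1 / (r:ℝ)) / 16 := by unfold gam; field_simp; norm_num
  · have h1 : gam r = (1 / (r:ℝ)) * ((1 / (r:ℝ)) * (1 / (r:ℝ))) / 8 := by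
      unfold gam; field_simp
    have h2 : (1 / (r:ℝ)) ≤ 1/5 := one_div_le_one_div_of_le (by norm_num) hr5
    have h3 : 0 < 1 / (r:ℝ) := by positivity
    have h4 : (1 / (r:ℝ)) * (1 / (r:ℝ)) ≤ 1/25 := by nlinarith
    rw [h1]
    nlinarith


lemma powb (hn : 1 ≤ n) (hp : 0 < p) (hpn : p ≤ (n:ℝ) ^ (-2 / (r:ℝ) + gam r)) (e : ℕ) : p ^ e ≤ (n:ℝ) ^ ((-2 / (r:ℝ) + gam r) * e) := by
  have hn0 : (0:ℝ) ≤ n := Nat.cast_nonneg _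
  rw [Real.rpow_mul hn0, Real.rpow_natCast]
  exact pow_le_pow_left₀ hp.le hpn e

/-- combined bound -/
lemma powb2 (hn : 1 ≤ n) (hp : 0 < p) (hpn : p ≤ (n:ℝ) ^ (-2 / (r:ℝ) + gam r)) (v e : ℕ) {x : ℝ} (hx : (v:ℝ) + (-2 / (r:ℝ) + gam r) * e ≤ x) :
    (n:ℝ) ^ v * p ^ e ≤ (n:ℝ) ^ x := by
  have hn1 : (1:ℝ) ≤ n := by exact_mod_cast hn
  have hn0 : (0:ℝ) < n := by linarith
  calc (n:ℝ) ^ v * p ^ e ≤ (n:ℝ) ^ v * (n:ℝ) ^ ((-2 / (r:ℝ) + gam r) * e) :=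
        mul_le_mul_of_nonneg_left (powb hn hp hpn e) (by positivity)
    _ = (n:ℝ) ^ ((v:ℝ) + (-2 / (r:ℝ) + gam r) * e) := by
        rw [Real.rpow_add hn0, Real.rpow_natCast]
    _ ≤ (n:ℝ) ^ x := Real.rpow_le_rpow_of_exponent_le hn1 hx

lemma mu_le (hn : 1 ≤ n) (hp : 0 < p) (hpn : p ≤ (n:ℝ) ^ (-2 / (r:ℝ) + gam r)) (hr : 5 ≤ r) : muR n r p ≤ (n:ℝ) ^ (1 + gam r * (r.choose 2 : ℝ)) := by
  have hR := choose_two_real r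
  have hr0 : (0:ℝ) < r := by exact_mod_cast (by omega : 0 < r)
  have h1 : (n.choose r : ℝ) ≤ (n:ℝ) ^ r := by exact_mod_cast Nat.choose_le_pow n r
  refine (mul_le_mul_of_nonneg_right h1 (pow_nonneg hp.le _)).trans (powb2 hn hp hpn r _ (le_of_eq ?_))
  have : (r.choose 2 : ℝ) = r * (r - 1) / 2 := by linarith
  rw [this]; field_simp; ring

lemma lamS_le (hn : 1 ≤ n) (hp : 0 < p) (hpn : p ≤ (n:ℝ) ^ (-2 / (r:ℝ) + gam r)) (hr : 5 ≤ r) : lamS n r p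
    ≤ (r * 2 ^ r) * (n:ℝ) ^ (-1 + 2 * (1 / (r:ℝ)) + gam r * (r.choose 2 : ℝ)) := by
  obtain ⟨hg, -⟩ := gam_facts hr
  have hR := choose_two_real r
  have hr0 : (0:ℝ) < r := by exact_mod_cast (by omega : 0 < r)
  have hn0 : (0:ℝ) ≤ n := Nat.cast_nonneg _
  unfold lamS
  have key : ∀ s ∈ Finset.Icc 2 (r - 1), (r.choose s : ℝ) * ((n - r).choose (r - s) : ℝ) *
      p ^ (r.choose 2 - s.choose 2) ≤ 2 ^ r * (n:ℝ) ^ (-1 + 2 * (1 / (r:ℝ)) + gam r * (r.choose 2 : ℝ)) := by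
    intro s hs
    rw [Finset.mem_Icc] at hs
    have hS := choose_two_real s
    have h1 : (r.choose s : ℝ) ≤ 2 ^ r := by exact_mod_cast Nat.choose_le_two_pow r s
    have h2 : ((n - r).choose (r - s) : ℝ) ≤ (n:ℝ) ^ (r - s) := by
      have : (n - r).choose (r - s) ≤ n ^ (r - s) :=
        (Nat.choose_le_choose _ (Nat.sub_le n r)).trans (Nat.choose_le_pow n (r - s))
      exact_mod_cast this
    rw [mul_assoc]
    refine mul_le_mul h1 ?_ (by positivity) (by positivity)
    refine (mul_le_mul_of_nonneg_right h2 (pow_nonneg hp.le _)).trans (powb2 hn hp hpn _ _ ?_)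
    have hle : s.choose 2 ≤ r.choose 2 := Nat.choose_le_choose 2 (by omega)
    rw [Nat.cast_sub (by omega : s ≤ r), Nat.cast_sub hle]
    have hs2 : (2:ℝ) ≤ s := by exact_mod_cast hs.1
    have hsr : (s:ℝ) ≤ r - 1 := by
      have : s + 1 ≤ r := by omega
      have : (s:ℝ) + 1 ≤ r := by exact_mod_cast this
      linarith
    have e1 : (r.choose 2 : ℝ) = r * (r - 1) / 2 := by linarith
    have e2 : (s.choose 2 : ℝ) = s * (s - 1) / 2 := by linarith
    have e3 : 0 ≤ gam r * (s.choose 2 : ℝ) := by positivity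
    have e4 : (r:ℝ) - s + (-2 / r) * ((r.choose 2 : ℝ) - s.choose 2) ≤ -1 + 2 * (1 / r) := by
      rw [e1, e2]
      have : (r:ℝ) - s + (-2 / r) * (r * (r - 1) / 2 - s * (s - 1) / 2) - (-1 + 2 * (1 / r))
          = -((s - 2) * (r - 1 - s)) / r := by field_simp; ring
      have h3 : -(((s:ℝ) - 2) * (r - 1 - s)) / r ≤ 0 := by
        apply div_nonpos_of_nonpos_of_nonneg _ hr0.le
        have := mul_nonneg (sub_nonneg.2 hs2) (sub_nonneg.2 hsr)
        linarith
      linarith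
    nlinarith
  refine (Finset.sum_le_sum key).trans ?_
  rw [Finset.sum_const, nsmul_eq_mul, ← mul_assoc]
  refine mul_le_mul_of_nonneg_right (mul_le_mul_of_nonneg_right ?_ (by positivity)) (Real.rpow_nonneg hn0 _)
  rw [Nat.card_Icc]
  exact_mod_cast (by omega : r - 1 + 1 - 2 ≤ r)

lemma Npi_le (hn : 1 ≤ n) (hp : 0 < p) (hpn : p ≤ (n:ℝ) ^ (-2 / (r:ℝ) + gam r)) (hr : 5 ≤ r) : (n.choose r : ℝ) * (p ^ r.choose 2) ^ 2 ≤ (n:ℝ) ^ (-(2 * gam r)) := by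
  obtain ⟨hg, hx5, hx0, hη, hη0, hγ⟩ := gam_facts hr
  have hR := choose_two_real r
  have hr5 : (5:ℝ) ≤ r := by exact_mod_cast hr
  have hr0 : (0:ℝ) < r := by linarith
  have h1 : (n.choose r : ℝ) ≤ (n:ℝ) ^ r := by exact_mod_cast Nat.choose_le_pow n r
  rw [← pow_mul]
  refine (mul_le_mul_of_nonneg_right h1 (pow_nonneg hp.le _)).trans (powb2 hn hp hpn r _ ?_)
  push_cast
  have e4 : (-2 / (r:ℝ)) * ((r.choose 2 : ℝ) * 2) = -2 * (r - 1) := by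
    rw [mul_comm (r.choose 2 : ℝ) 2, hR]; field_simp
  rw [add_mul, e4]
  nlinarith

lemma pr1_le (hn : 1 ≤ n) (hp : 0 < p) (hpn : p ≤ (n:ℝ) ^ (-2 / (r:ℝ) + gam r)) (hr : 5 ≤ r) : p ^ (r - 1) ≤ (n:ℝ) ^ (-1 : ℝ) := by
  obtain ⟨hg, hx5, hx0, hη, hη0, hγ⟩ := gam_facts hr
  have hr5 : (5:ℝ) ≤ r := by exact_mod_cast hr
  have hr0 : (0:ℝ) < r := by linarith
  have := powb2 hn hp hpn 0 (r - 1) (x := -1) ?_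
  · simpa using this
  · rw [Nat.cast_sub (by omega : 1 ≤ r)]
    have hc : ((r:ℝ) - 1) ≤ r.choose 2 := by
      have := choose_ge r (by omega)
      have h2 : ((r - 1 : ℕ) : ℝ) ≤ r.choose 2 := by exact_mod_cast this
      rwa [Nat.cast_sub (by omega : 1 ≤ r), Nat.cast_one] at h2
    have h3 := mul_le_mul_of_nonneg_left hc hg.le
    have e : (-2 / (r:ℝ)) * ((r:ℝ) - 1) = -2 + 2 * (1 / r) := by field_simp; ring
    push_cast
    rw [add_mul, e]
    linarith

lemma T3s_bd (hn : 1 ≤ n) (hp : 0 < p) (hpn : p ≤ (n:ℝ) ^ (-2 / (r:ℝ) + gam r))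
    (hr : 5 ≤ r) : T3s n r p ≤ 8 ^ (3 * r) * (((n.choose (r + 1) : ℝ) * p ^ (r + 1).choose 2)
    + (3 * r + 1) * (n:ℝ) ^ (-(2 * gam r))) := by
  obtain ⟨hg, hx5, hx0, hη, hη0, hγ⟩ := gam_facts hr
  have hr0 : (0:ℝ) < r := by exact_mod_cast (by omega : 0 < r)
  have hn0 : (0:ℝ) < n := by exact_mod_cast hn
  refine T3s_le hr hn hp.le (Real.rpow_nonneg hn0.le _) fun v e hve he => ?_
  rw [← div_eq_mul_inv, le_div_iff₀ (by positivity), mul_comm]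
  refine powb2 hn hp hpn v e ?_
  have h1 : (r:ℝ) * v + 1 ≤ 2 * e := by exact_mod_cast hve
  have h2 : (e:ℝ) ≤ 3 * (r.choose 2 : ℝ) := by exact_mod_cast he
  have h3 := mul_le_mul_of_nonneg_left h2 hg.le
  have h4 := mul_le_mul_of_nonneg_left h1 hx0.le
  have e1 : 1 / (r:ℝ) * (r * v + 1) = v + 1 / r := by field_simp
  have e2 : (-2 / (r:ℝ)) * e = -(1 / (r:ℝ) * (2 * e)) := by field_simp
  rw [add_mul, e2]
  linarith

noncomputable def C2 (r : ℕ) : ℝ := 2 ^ (3 * r.choose 2) * (3 * (8 ^ (3 * r) * (3 * r + 2)) + 2 * (r * 2 ^ r))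
    + 1 + (r * 2 ^ r) + (r * 2 ^ r) * (1 + r * 2 ^ r)

lemma scal {P E ρ D m z T q l N F : ℝ} (hP : 0 ≤ P) (hE : 0 ≤ E) (hρ : 0 ≤ ρ) (hD : 0 ≤ D)
    (hm : 0 ≤ m) (hz : 0 ≤ z) (b1 : T ≤ E * (m + (3 * ρ + 1) * z)) (c2 : q ≤ D * z)
    (b5 : N ≤ z) (c3 : l ≤ D * z) (c6 : F ≤ D * z * (1 + D)) :
    P * (3 * T + 2 * q) + N + (l + F) ≤
      (P * (3 * (E * (3 * ρ + 2)) + 2 * D) + 1 + D + D * (1 + D)) * (m + z) := by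
  have h1 : E * (m + (3 * ρ + 1) * z) ≤ E * ((3 * ρ + 2) * (m + z)) := by
    refine mul_le_mul_of_nonneg_left ?_ hE
    nlinarith [mul_nonneg hρ hm]
  have h2 : q ≤ D * (m + z) := c2.trans (mul_le_mul_of_nonneg_left (by linarith) hD)
  have h3 : P * (3 * T + 2 * q) ≤ P * (3 * (E * ((3 * ρ + 2) * (m + z))) + 2 * (D * (m + z))) :=
    mul_le_mul_of_nonneg_left (by linarith) hP
  have h4 := mul_nonneg hD hm
  have h5 := mul_nonneg (mul_nonneg hD hD) hm
  calc _ ≤ P * (3 * (E * ((3 * ρ + 2) * (m + z))) + 2 * (D * (m + z))) + z + (D * z + D * z * (1 + D)) := by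
        linarith
    _ ≤ P * (3 * (E * ((3 * ρ + 2) * (m + z))) + 2 * (D * (m + z))) + (m + z)
        + (D * (m + z) + D * (m + z) * (1 + D)) := by
        have : D * (m + z) + D * (m + z) * (1 + D) = D * z + D * z * (1 + D) + (2 * (D * m) + D * D * m) := by ring
        linarith
    _ = _ := by ring

lemma EErr_bd (hn : 1 ≤ n) (hp : 0 < p) (hpn : p ≤ (n:ℝ) ^ (-2 / (r:ℝ) + gam r)) (hr : 5 ≤ r) (hp1 : p ≤ 1) : ex (pairsUniv n) p (Err n r p)
    ≤ C2 r * (((n.choose (r + 1) : ℝ) * p ^ (r + 1).choose 2) + (n:ℝ) ^ (-(2 * gam r))) := by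
  obtain ⟨hg, hx5, hx0, hη, hη0, hγ⟩ := gam_facts hr
  have hr0 : (0:ℝ) < r := by exact_mod_cast (by omega : 0 < r)
  have hn1 : (1:ℝ) ≤ n := by exact_mod_cast hn
  have hn0 : (0:ℝ) < n := by linarith
  have ha : 0 < (n:ℝ) ^ (1/2 : ℝ) := Real.rpow_pos_of_pos hn0 _
  refine (EErr (by omega) hp.le hp1 ha).trans ?_
  have b1 := T3s_bd hn hp hpn hr
  have b2 := pr1_le hn hp hpn hr
  have b3 := mu_le hn hp hpn hr
  have b4 := lamS_le hn hp hpn hr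
  have b5 := Npi_le hn hp hpn hr
  set D : ℝ := r * 2 ^ r with hD
  have hD0 : 0 ≤ D := by positivity
  have hl0 := lamS_nonneg (n := n) (r := r) hp.le
  have hm0 : 0 ≤ muR n r p := by unfold muR; positivity
  set η := gam r * (r.choose 2 : ℝ)
  set m1 := ((n.choose (r + 1) : ℝ) * p ^ (r + 1).choose 2) with hm1
  have hm10 : 0 ≤ m1 := by positivity
  set z := (n:ℝ) ^ (-(2 * gam r)) with hz
  have hz0 : 0 ≤ z := Real.rpow_nonneg hn0.le _
  have mono : ∀ x : ℝ, x ≤ -(2 * gam r) → (n:ℝ) ^ x ≤ z := fun x hx =>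
    Real.rpow_le_rpow_of_exponent_le hn1 hx
  -- product bounds
  have c1 : muR n r p * lamS n r p ≤ D * (n:ℝ) ^ (2 * (1 / (r:ℝ)) + 2 * η) := by
    refine (mul_le_mul b3 b4 hl0 (Real.rpow_nonneg hn0.le _)).trans (le_of_eq ?_)
    rw [mul_left_comm, ← Real.rpow_add hn0]
    congr 2; ring
  have c1' : 0 ≤ muR n r p * lamS n r p := mul_nonneg hm0 hl0
  have c2 : p ^ (r - 1) * (muR n r p * lamS n r p) ≤ D * z := by
    refine (mul_le_mul b2 c1 c1' (Real.rpow_nonneg hn0.le _)).trans ?_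
    rw [mul_left_comm, ← Real.rpow_add hn0]
    exact mul_le_mul_of_nonneg_left (mono _ (by linarith)) hD0
  have c3 : lamS n r p * (n:ℝ) ^ (1/2 : ℝ) ≤ D * z := by
    refine (mul_le_mul_of_nonneg_right b4 ha.le).trans ?_
    rw [mul_assoc, ← Real.rpow_add hn0]
    exact mul_le_mul_of_nonneg_left (mono _ (by linarith)) hD0
  have c4 : lamS n r p ≤ D := by
    refine b4.trans (mul_le_of_le_one_right hD0 ?_)
    exact Real.rpow_le_one_of_one_le_of_nonpos hn1 (by linarith)
  have c5 : muR n r p * lamS n r p / (n:ℝ) ^ (1/2 : ℝ) ≤ D * z := by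
    rw [div_eq_mul_inv, ← Real.rpow_neg hn0.le]
    refine (mul_le_mul_of_nonneg_right c1 (Real.rpow_nonneg hn0.le _)).trans ?_
    rw [mul_assoc, ← Real.rpow_add hn0]
    exact mul_le_mul_of_nonneg_left (mono _ (by linarith)) hD0
  have c6 : lamS n r p * (muR n r p * (1 + lamS n r p) / (n:ℝ) ^ (1/2 : ℝ)) ≤ D * z * (1 + D) := by
    have : lamS n r p * (muR n r p * (1 + lamS n r p) / (n:ℝ) ^ (1/2 : ℝ))
      = (muR n r p * lamS n r p / (n:ℝ) ^ (1/2 : ℝ)) * (1 + lamS n r p) := by ring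
    rw [this]
    exact mul_le_mul c5 (by linarith) (by linarith) (by positivity)
  have hP0 : (0:ℝ) ≤ 2 ^ (3 * r.choose 2) := pow_nonneg (by norm_num) _
  have hE0 : (0:ℝ) ≤ 8 ^ (3 * r) := pow_nonneg (by norm_num) _
  have fin := scal hP0 hE0 hr0.le hD0 hm10 hz0 b1 c2 b5 c3 c6
  unfold C2
  rw [← hD, mul_add (lamS n r p), mul_assoc (2:ℝ)]
  exact fin

end Bounds


open Finset
open scoped Classical

lemma prob_ex (n : ℕ) (p : ℝ) (A : Set (Finset (Finset (Fin n)))) :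
    gnpProb n p A = ex (pairsUniv n) p (fun G => if G ∈ A then 1 else 0) := by
  unfold gnpProb ex
  rw [Finset.sum_filter]
  refine Finset.sum_congr rfl fun G _ => ?_
  beta_reduce
  by_cases h : G ∈ A
  · rw [if_pos h, if_pos h, mul_one]
  · rw [if_neg h, if_neg h, mul_zero]

lemma prob_le_one (n : ℕ) {p : ℝ} (hp : 0 ≤ p) (hp1 : p ≤ 1) (A : Set (Finset (Finset (Fin n)))) :
    gnpProb n p A ≤ 1 := by
  rw [prob_ex]
  refine le_trans (ex_mono (g := fun _ => 1) hp hp1 fun G _ => ?_) (ex_one (pairsUniv n) p).le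
  split_ifs <;> norm_num

lemma prob_markov {n r : ℕ} {p δ : ℝ} (hp : 0 ≤ p) (hp1 : p ≤ 1) (hδ : 0 < δ)
    (A : Set (Finset (Finset (Fin n)))) (hA : ∀ G, 8 * Err n r p G ≤ δ → G ∈ A) :
    1 - 8 / δ * ex (pairsUniv n) p (Err n r p) ≤ gnpProb n p A := by
  have e1 : 1 - 8 / δ * ex (pairsUniv n) p (Err n r p)
      = ex (pairsUniv n) p (fun G => 1 - 8 / δ * Err n r p G) := by
    rw [ex_sub _ _ (fun _ => 1) (fun G => 8 / δ * Err n r p G), ex_one, ex_mul]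
  rw [prob_ex, e1]
  refine ex_mono hp hp1 fun G _ => ?_
  show 1 - 8 / δ * Err n r p G ≤ if G ∈ A then 1 else 0
  have h0 := Err_nonneg (n := n) (r := r) hp hp1 G
  have h8 : 0 ≤ 8 / δ * Err n r p G := mul_nonneg (div_nonneg (by norm_num) hδ.le) h0
  split_ifs with h
  · linarith
  · have : δ < 8 * Err n r p G := lt_of_not_ge fun h' => h (hA G h')
    have h2 : 1 ≤ 8 / δ * Err n r p G := by
      rw [div_mul_eq_mul_div, le_div_iff₀ hδ]; linarith
    linarith

lemma C2_nonneg (r : ℕ) : 0 ≤ C2 r := by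
  unfold C2
  have hD : (0:ℝ) ≤ (r:ℝ) * 2 ^ r := mul_nonneg (Nat.cast_nonneg _) (pow_nonneg (by norm_num) _)
  have hP : (0:ℝ) ≤ 2 ^ (3 * r.choose 2) := pow_nonneg (by norm_num) _
  have hE : (0:ℝ) ≤ 8 ^ (3 * r) := pow_nonneg (by norm_num) _
  have hr : (0:ℝ) ≤ r := Nat.cast_nonneg _
  have h1 := mul_nonneg hE (by linarith : (0:ℝ) ≤ 3 * (r:ℝ) + 2)
  have h2 := mul_nonneg hP (by linarith :
    (0:ℝ) ≤ 3 * ((8:ℝ) ^ (3 * r) * (3 * (r:ℝ) + 2)) + 2 * ((r:ℝ) * 2 ^ r))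
  have h3 := mul_nonneg hD (by linarith : (0:ℝ) ≤ 1 + (r:ℝ) * 2 ^ r)
  linarith

lemma ratio_le {m z w : ℝ} (hm : 0 ≤ m) (hz : 0 < z) (hw : 0 < w) :
    (m + z * z) / (w * m + z) ≤ 1 / w + z := by
  have h0 := mul_nonneg hw.le hm
  have hd : 0 < w * m + z := by linarith
  rw [div_le_iff₀ hd]
  have e : (1 / w + z) * (w * m + z) = m + z * z + (1 / w * z + z * (w * m)) := by
    field_simp; ring
  have h1 : 0 ≤ 1 / w * z := by positivity
  have h2 := mul_nonneg hz.le h0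
  linarith

/-- the good family -/
def goodFam (n r : ℕ) (p δ : ℝ) : Set (Finset (Finset (Fin n))) :=
  {H | (∀ e ∈ H, e.card = r) ∧
    Real.exp (-δ) * tgt n r p H ≤ gnpProb n p {G | cliqueHyp n r G = H} ∧
    gnpProb n p {G | cliqueHyp n r G = H} ≤ Real.exp δ * tgt n r p H}

lemma goodFam_prob {n r : ℕ} {p w : ℝ} (hr : 5 ≤ r) (hn : 1 ≤ n) (hp : 0 < p) (hp2 : p ≤ 1/2)
    (hpn : p ≤ (n:ℝ) ^ (-2 / (r:ℝ) + gam r)) (hw : 0 < w) :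
    1 - 8 * C2 r * (1 / w + (n:ℝ) ^ (-gam r)) ≤
      gnpProb n p {G | cliqueHyp n r G ∈ goodFam n r p
        (1 * (w * ((n.choose (r + 1) : ℝ) * p ^ (r + 1).choose 2) + (n : ℝ) ^ (-gam r)))} := by
  have hn0 : (0:ℝ) < n := by exact_mod_cast hn
  have hb := EErr_bd hn hp hpn hr (by linarith)
  have hm : (0:ℝ) ≤ (n.choose (r + 1) : ℝ) * p ^ (r + 1).choose 2 :=
    mul_nonneg (Nat.cast_nonneg _) (pow_nonneg hp.le _)
  have hz : 0 < (n:ℝ) ^ (-gam r) := Real.rpow_pos_of_pos hn0 _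
  have hzz : (n:ℝ) ^ (-(2 * gam r)) = (n:ℝ) ^ (-gam r) * (n:ℝ) ^ (-gam r) := by
    rw [← Real.rpow_add hn0]; congr 1; ring
  rw [hzz] at hb
  generalize (n.choose (r + 1) : ℝ) * p ^ (r + 1).choose 2 = m at *
  generalize (n:ℝ) ^ (-gam r) = z at *
  have hδ : 0 < 1 * (w * m + z) := by
    have := mul_nonneg hw.le hm
    linarith
  refine le_trans ?_ (prob_markov (r := r) hp.le (by linarith) hδ _ ?_)
  · have h8 : 0 ≤ 8 / (1 * (w * m + z)) := (div_pos (by norm_num) hδ).le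
    have h1 := mul_le_mul_of_nonneg_left hb h8
    have h2 := mul_le_mul_of_nonneg_left (ratio_le hm hz hw)
      (mul_nonneg (by norm_num : (0:ℝ) ≤ 8) (C2_nonneg r))
    have e : 8 / (1 * (w * m + z)) * (C2 r * (m + z * z))
      = 8 * C2 r * ((m + z * z) / (w * m + z)) := by rw [one_mul]; ring
    linarith
  · intro G hG
    refine ⟨fun e he => ?_, pointwise (by omega) hp hp2 _ rfl _ hG⟩
    exact (Finset.mem_powersetCard.1 (Finset.mem_filter.1 he).1).2

theorem clique_distribution_constant_r (r : ℕ) (hr : 5 ≤ r) :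
    ∃ γ : ℝ, 0 < γ ∧
      ∀ p : ℕ → ℝ, (∀ n, 0 < p n ∧ p n < 1) →
        (∀ n : ℕ, 1 ≤ n → p n ≤ (n : ℝ) ^ (-2 / (r : ℝ) + γ)) →
        Filter.Tendsto (fun n => muR n r (p n)) Filter.atTop Filter.atTop →
        ∀ ω : ℕ → ℝ, Filter.Tendsto ω Filter.atTop Filter.atTop →
        ∃ K : ℝ, 0 < K ∧
        ∃ 𝒢 : (n : ℕ) → Set (Finset (Finset (Fin n))),
          (∀ n, ∀ H ∈ 𝒢 n, ∀ e ∈ H, e.card = r) ∧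
          Filter.Tendsto (fun n => gnpProb n (p n) {G | cliqueHyp n r G ∈ 𝒢 n})
            Filter.atTop (nhds 1) ∧
          ∀ᶠ n in Filter.atTop, ∀ H ∈ 𝒢 n,
            Real.exp (-(K * (ω n * ((n.choose (r + 1) : ℝ) * p n ^ (r + 1).choose 2)
                + (n : ℝ) ^ (-γ)))) *
              ((p n ^ r.choose 2) ^ H.card * (1 - p n ^ r.choose 2) ^ (n.choose r - H.card) *
                p n ^ (-(tHyp n r H)) * Real.exp (-(Lam n r (p n))))
              ≤ gnpProb n (p n) {G | cliqueHyp n r G = H} ∧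
            gnpProb n (p n) {G | cliqueHyp n r G = H} ≤
              Real.exp (K * (ω n * ((n.choose (r + 1) : ℝ) * p n ^ (r + 1).choose 2)
                + (n : ℝ) ^ (-γ))) *
              ((p n ^ r.choose 2) ^ H.card * (1 - p n ^ r.choose 2) ^ (n.choose r - H.card) *
                p n ^ (-(tHyp n r H)) * Real.exp (-(Lam n r (p n)))) := by
  obtain ⟨hg, hx5, hx0, -, -, hγ⟩ := gam_facts hr
  refine ⟨gam r, hg, ?_⟩
  intro p hp hpn _ ω hω
  refine ⟨1, one_pos, fun n => goodFam n r (p n)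
    (1 * (ω n * ((n.choose (r + 1) : ℝ) * p n ^ (r + 1).choose 2) + (n : ℝ) ^ (-gam r))),
    fun n H hH => hH.1, ?_, Filter.Eventually.of_forall fun n H hH => hH.2⟩
  have hcast : Filter.Tendsto (fun n : ℕ => (n:ℝ)) Filter.atTop Filter.atTop :=
    tendsto_natCast_atTop_atTop
  have hz : Filter.Tendsto (fun n : ℕ => (n:ℝ) ^ (-gam r)) Filter.atTop (nhds 0) :=
    (tendsto_rpow_neg_atTop hg).comp hcast
  have hw : Filter.Tendsto (fun n : ℕ => 1 / ω n) Filter.atTop (nhds 0) := by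
    simp only [one_div]
    exact hω.inv_tendsto_atTop
  have hlow : Filter.Tendsto (fun n : ℕ => 1 - 8 * C2 r * (1 / ω n + (n:ℝ) ^ (-gam r)))
      Filter.atTop (nhds 1) := by
    have := ((hw.add hz).const_mul (8 * C2 r)).const_sub 1
    simpa using this
  have hneg : 0 < 2 / (r:ℝ) - gam r := by
    have : 2 / (r:ℝ) = 2 * (1 / r) := by ring
    rw [this]; linarith
  have hp0 : Filter.Tendsto (fun n : ℕ => (n:ℝ) ^ (-2 / (r:ℝ) + gam r)) Filter.atTop (nhds 0) := by
    have := (tendsto_rpow_neg_atTop hneg).comp hcast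
    have e : -(2 / (r:ℝ) - gam r) = -2 / (r:ℝ) + gam r := by ring
    rw [e] at this
    exact this
  have hp2 : ∀ᶠ n : ℕ in Filter.atTop, (n:ℝ) ^ (-2 / (r:ℝ) + gam r) < 1/2 :=
    hp0.eventually_lt_const (by norm_num)
  refine tendsto_of_tendsto_of_tendsto_of_le_of_le' hlow tendsto_const_nhds ?_
    (Filter.Eventually.of_forall fun n => prob_le_one n (hp n).1.le (hp n).2.le _)
  filter_upwards [hp2, hω.eventually_gt_atTop 0, Filter.eventually_ge_atTop 1] with n h1 h2 h3
  exact goodFam_prob hr h3 (hp n).1 ((hpn n h3).trans h1.le) (hpn n h3) h2
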